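/- arXiv:1007.4154 — 2 statements merged into one kernel-verified Lean document; each statement's English description precedes it below -/
import Mathlib

section
/- Fix p with 0.12 ≤ p ≤ 1. For n ≥ 5, let G be sampled uniformly at random from the (nonempty, finite) set of 4-regular simple graphs on the vertex set Fin n, and let the random seed set S^p include each vertex independently with probability p (independently of G). Then the probability that S^p is a dynamo on G under the majority coloring process of threshold 2 tends to 1 as n → ∞. -/
open MeasureTheory Filter

/-- The toroidal mesh of size `n`: vertices `(ZMod n) × (ZMod n)`, with `(i,j)`
adjacent to `(i±1,j)` and `(i,j±1)`. -/
def torus (n : ℕ) : SimpleGraph (ZMod n × ZMod n) :=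
  SimpleGraph.fromRel (fun v w => w = (v.1 + 1, v.2) ∨ w = (v.1, v.2 + 1))

/-- One step of the majority coloring process with threshold 2: a vertex turns black
if it has at least two black neighbors; black vertices stay black. -/
def colorStep {V : Type*} (G : SimpleGraph V) (S : Set V) : Set V :=
  S ∪ {v | ∃ u w, u ≠ w ∧ G.Adj v u ∧ G.Adj v w ∧ u ∈ S ∧ w ∈ S}

/-- `S` is a dynamo if every vertex eventually turns black. -/
def IsDynamo {V : Type*} (G : SimpleGraph V) (S : Set V) : Prop :=
  ∀ v, ∃ t, v ∈ (colorStep G)^[t] S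

/-- The Bernoulli(p) measure on `Bool`. -/
noncomputable def bernoulliMeasure (p : ℝ) : Measure Bool :=
  ENNReal.ofReal p • Measure.dirac true + ENNReal.ofReal (1 - p) • Measure.dirac false

instance (p : ℝ) : IsFiniteMeasure (bernoulliMeasure p) := by
  constructor
  simp [bernoulliMeasure, ENNReal.add_lt_top, ENNReal.ofReal_lt_top]

/-- The product Bernoulli(p) measure on subsets (indicator functions) of `V`. -/
noncomputable def seedMeasure (V : Type*) [Fintype V] (p : ℝ) : Measure (V → Bool) :=
  Measure.pi fun _ => bernoulliMeasure p

-- The finite set of 4-regular simple graphs on `Fin n`.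
open scoped Classical in
noncomputable def regGraphs (n : ℕ) : Finset (SimpleGraph (Fin n)) :=
  Finset.univ.filter (fun G => ∀ v, (G.neighborSet v).ncard = 4)


section Switching
open scoped Classical

/-- The switched graph: remove `uv`, `ab`, add `ua`, `vb`. -/
def switchGraph {V : Type*} (G : SimpleGraph V) (u v a b : V) : SimpleGraph V where
  Adj x y := x ≠ y ∧ ((G.Adj x y ∧ s(x, y) ≠ s(u, v) ∧ s(x, y) ≠ s(a, b)) ∨
    s(x, y) = s(u, a) ∨ s(x, y) = s(v, b))
  symm := ⟨by
    intro x y h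
    refine ⟨h.1.symm, ?_⟩
    rw [Sym2.eq_swap, G.adj_comm]
    exact h.2⟩
  loopless := ⟨fun x h => h.1 rfl⟩

/-- The pair `(a, b)` can be used for switching out the edge `uv`, keeping `F`. -/
def ValidPair {V : Type*} (G : SimpleGraph V) (F : Finset (Sym2 V)) (u v a b : V) : Prop :=
  G.Adj a b ∧ s(a, b) ∉ F ∧ (a ≠ u ∧ a ≠ v ∧ ¬ G.Adj u a) ∧ (b ≠ u ∧ b ≠ v ∧ ¬ G.Adj v b)

lemma ncard_swap {V : Type*} [Finite V] (s : Set V) (a v : V) (hv : v ∈ s) (ha : a ∉ s) :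
    (insert a (s \ {v})).ncard = s.ncard := by
  rw [Set.ncard_insert_of_notMem (by simp [ha])]
  exact Set.ncard_sdiff_singleton_add_one hv

lemma switch_regular {V : Type*} [Finite V] (G : SimpleGraph V) (F : Finset (Sym2 V))
    (u v a b : V) (huv : G.Adj u v) (h : ValidPair G F u v a b) (x : V) :
    ((switchGraph G u v a b).neighborSet x).ncard = (G.neighborSet x).ncard := by
  obtain ⟨hab, hF, ⟨hau, hav, hua⟩, ⟨hbu, hbv, hvb⟩⟩ := h
  have h1 := hab.ne
  have h2 := huv.ne
  by_cases hxu : x = u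
  · subst hxu
    rw [← ncard_swap (G.neighborSet x) a v huv hua]
    congr 1
    ext y
    simp only [SimpleGraph.mem_neighborSet, switchGraph, Set.mem_insert_iff, Set.mem_sdiff,
      Set.mem_singleton_iff, Sym2.eq_iff, ne_eq]
    have := G.ne_of_adj (a := x) (b := y)
    grind
  by_cases hxv : x = v
  · subst hxv
    rw [← ncard_swap (G.neighborSet x) b u huv.symm hvb]
    congr 1
    ext y
    simp only [SimpleGraph.mem_neighborSet, switchGraph, Set.mem_insert_iff, Set.mem_sdiff,
      Set.mem_singleton_iff, Sym2.eq_iff, ne_eq]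
    have := G.ne_of_adj (a := x) (b := y)
    grind
  by_cases hxa : x = a
  · subst hxa
    rw [← ncard_swap (G.neighborSet x) u b hab (fun h => hua h.symm)]
    congr 1
    ext y
    simp only [SimpleGraph.mem_neighborSet, switchGraph, Set.mem_insert_iff, Set.mem_sdiff,
      Set.mem_singleton_iff, Sym2.eq_iff, ne_eq]
    have := G.ne_of_adj (a := x) (b := y)
    grind
  by_cases hxb : x = b
  · subst hxb
    rw [← ncard_swap (G.neighborSet x) v a hab.symm (fun h => hvb h.symm)]
    congr 1
    ext y
    simp only [SimpleGraph.mem_neighborSet, switchGraph, Set.mem_insert_iff, Set.mem_sdiff,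
      Set.mem_singleton_iff, Sym2.eq_iff, ne_eq]
    have := G.ne_of_adj (a := x) (b := y)
    grind
  congr 1
  ext y
  simp only [SimpleGraph.mem_neighborSet, switchGraph, Sym2.eq_iff, ne_eq]
  have := G.ne_of_adj (a := x) (b := y)
  grind

lemma switch_inj {V : Type*} (G G' : SimpleGraph V) (F : Finset (Sym2 V))
    (u v a b : V) (huv : G.Adj u v) (h : ValidPair G F u v a b)
    (huv' : G'.Adj u v) (h' : ValidPair G' F u v a b)
    (he : switchGraph G u v a b = switchGraph G' u v a b) : G = G' := by
  obtain ⟨hab, hF, ⟨hau, hav, hua⟩, ⟨hbu, hbv, hvb⟩⟩ := h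
  obtain ⟨hab', -, ⟨-, -, hua'⟩, ⟨-, -, hvb'⟩⟩ := h'
  ext x y
  have hxy : (switchGraph G u v a b).Adj x y ↔ (switchGraph G' u v a b).Adj x y := by rw [he]
  simp only [switchGraph, ne_eq] at hxy
  rw [← SimpleGraph.mem_edgeSet, ← SimpleGraph.mem_edgeSet] at *
  have e1 : x = y → s(x,y) ∉ G.edgeSet := by rintro rfl; simp
  have e2 : x = y → s(x,y) ∉ G'.edgeSet := by rintro rfl; simp
  grind

/-- graphs in `regGraphs n` containing all edges in `F`. -/
noncomputable def regWith (n : ℕ) (F : Finset (Sym2 (Fin n))) : Finset (SimpleGraph (Fin n)) :=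
  (regGraphs n).filter (fun G => (F : Set (Sym2 (Fin n))) ⊆ G.edgeSet)

lemma mem_regGraphs {n : ℕ} {G : SimpleGraph (Fin n)} :
    G ∈ regGraphs n ↔ ∀ v, (G.neighborSet v).ncard = 4 := by
  simp [regGraphs]

lemma degree_of_reg {n : ℕ} {G : SimpleGraph (Fin n)} (h : G ∈ regGraphs n) (v : Fin n) :
    (Finset.univ.filter (fun x => G.Adj v x)).card = 4 := by
  rw [← mem_regGraphs.1 h v, Set.ncard_eq_toFinset_card']
  congr 1
  ext x
  simp

lemma valid_count {n : ℕ} {G : SimpleGraph (Fin n)} (h : G ∈ regGraphs n)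
    (F : Finset (Sym2 (Fin n))) (u v : Fin n) :
    4 * n ≤ (Finset.univ.filter
      (fun ab : Fin n × Fin n => ValidPair G F u v ab.1 ab.2)).card + 2 * F.card + 48 := by
  have htot : (Finset.univ.filter (fun ab : Fin n × Fin n => G.Adj ab.1 ab.2)).card = 4 * n := by
    rw [Finset.card_filter, Fintype.sum_prod_type]
    simp_rw [← Finset.card_filter]
    simp [degree_of_reg h, mul_comm]
  have hsub : (Finset.univ.filter (fun ab : Fin n × Fin n => G.Adj ab.1 ab.2)) ⊆
      (Finset.univ.filter (fun ab : Fin n × Fin n => ValidPair G F u v ab.1 ab.2)) ∪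
      (Finset.univ.filter (fun ab : Fin n × Fin n => s(ab.1, ab.2) ∈ F)) ∪
      ((insert u (insert v (Finset.univ.filter (fun x => G.Adj u x)))).biUnion
        (fun a => (Finset.univ.filter (fun x => G.Adj a x)).image (fun x => (a, x)))) ∪
      ((insert u (insert v (Finset.univ.filter (fun x => G.Adj v x)))).biUnion
        (fun b => (Finset.univ.filter (fun x => G.Adj b x)).image (fun x => (x, b)))) := by
    rintro ⟨a, b⟩ hab
    simp only [Finset.mem_filter, Finset.mem_univ, true_and] at hab
    simp only [Finset.mem_union, Finset.mem_filter, Finset.mem_univ, true_and, Finset.mem_biUnion,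
      Finset.mem_insert, Finset.mem_image, Prod.mk.injEq]
    by_cases h1 : s(a,b) ∈ F
    · simp [h1]
    by_cases h2 : a = u ∨ a = v ∨ G.Adj u a
    · left; right
      exact ⟨a, h2, b, hab, rfl, rfl⟩
    by_cases h3 : b = u ∨ b = v ∨ G.Adj v b
    · right
      exact ⟨b, h3, a, hab.symm, rfl, rfl⟩
    · left; left; left
      unfold ValidPair
      tauto
  have hF : (Finset.univ.filter (fun ab : Fin n × Fin n => s(ab.1, ab.2) ∈ F)).card
      ≤ 2 * F.card := by
    have : (Finset.univ.filter (fun ab : Fin n × Fin n => s(ab.1, ab.2) ∈ F)) =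
       F.biUnion (fun e => Finset.univ.filter (fun ab : Fin n × Fin n => s(ab.1, ab.2) = e)) := by
      ext ab; simp
    rw [this, mul_comm]
    apply Finset.card_biUnion_le_card_mul
    intro e _
    induction e using Sym2.ind with
    | _ x y =>
      refine le_trans (Finset.card_le_card (t := {(x,y),(y,x)}) ?_) Finset.card_le_two
      rintro ⟨c, d⟩
      simp
  have hA : ∀ w, ((insert u (insert v (Finset.univ.filter (fun x => G.Adj w x))))).card ≤ 6 := by
    intro w
    have h1 := Finset.card_insert_le u (insert v (Finset.univ.filter (fun x => G.Adj w x)))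
    have h2 := Finset.card_insert_le v ((Finset.univ.filter (fun x => G.Adj w x)))
    have := degree_of_reg h w
    omega
  have hB : ∀ f : Fin n → Fin n → Fin n × Fin n, ∀ w,
      ((insert u (insert v (Finset.univ.filter (fun x => G.Adj w x)))).biUnion
        (fun a => (Finset.univ.filter (fun x => G.Adj a x)).image (fun x => f a x))).card ≤ 24 := by
    intro f w
    refine le_trans (Finset.card_biUnion_le_card_mul _ _ 4 ?_) ?_
    · intro a _
      exact le_trans Finset.card_image_le (degree_of_reg h a).le
    · have := hA w
      omega
  have h1 := Finset.card_le_card hsub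
  have h2 := hB (fun a x => (a,x)) u
  have h3 := hB (fun a x => (x,a)) v
  rw [htot] at h1
  refine h1.trans ?_
  refine (Finset.card_union_le _ _).trans ?_
  refine (Nat.add_le_add_right (Finset.card_union_le _ _) _).trans ?_
  refine (Nat.add_le_add_right (Nat.add_le_add_right (Finset.card_union_le _ _) _) _).trans ?_
  omega

lemma switching {n : ℕ} (F : Finset (Sym2 (Fin n))) (e : Sym2 (Fin n)) (he : e ∉ F)
    (hF : 2 * F.card ≤ n) (hn : 48 ≤ n) :
    (regWith n (insert e F)).card * n ≤ 8 * (regWith n F).card := by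
  induction e using Sym2.ind with
  | _ u v =>
  let A : Finset ((_ : SimpleGraph (Fin n)) × (Fin n × Fin n)) :=
    (regWith n (insert s(u,v) F)).sigma (fun G => Finset.univ.filter
      (fun ab : Fin n × Fin n => ValidPair G F u v ab.1 ab.2))
  let B : Finset ((_ : SimpleGraph (Fin n)) × (Fin n × Fin n)) :=
    (regWith n F).sigma (fun G => (Finset.univ.filter (fun x => G.Adj u x)) ×ˢ
      (Finset.univ.filter (fun x => G.Adj v x)))
  have hA : (regWith n (insert s(u,v) F)).card * (2 * n) ≤ A.card := by
    rw [Finset.card_sigma]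
    rw [← smul_eq_mul, ← Finset.sum_const]
    apply Finset.sum_le_sum
    intro G hG
    have := valid_count (Finset.mem_filter.1 hG).1 F u v
    omega
  have hB : B.card = 16 * (regWith n F).card := by
    rw [Finset.card_sigma, mul_comm, ← smul_eq_mul, ← Finset.sum_const]
    apply Finset.sum_congr rfl
    intro G hG
    rw [Finset.card_product, degree_of_reg (Finset.mem_filter.1 hG).1,
      degree_of_reg (Finset.mem_filter.1 hG).1]
  have key : ∀ x ∈ A, (∀ w, (x.1.neighborSet w).ncard = 4) ∧ x.1.Adj u v ∧
      (∀ e ∈ F, e ∈ x.1.edgeSet) ∧ ValidPair x.1 F u v x.2.1 x.2.2 := by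
    intro x hx
    simp only [A, regWith, Finset.mem_sigma, Finset.mem_filter, Finset.mem_univ, true_and,
      mem_regGraphs, Finset.coe_insert, Set.insert_subset_iff, SimpleGraph.mem_edgeSet] at hx
    exact ⟨hx.1.1, hx.1.2.1, fun e he => hx.1.2.2 he, hx.2⟩
  have hAB : A.card ≤ B.card := by
    apply Finset.card_le_card_of_injOn (fun x => ⟨switchGraph x.1 u v x.2.1 x.2.2, x.2⟩)
    · intro x hx
      obtain ⟨h1, h2, h3, h4⟩ := key x hx
      obtain ⟨G, a, b⟩ := x
      have h5 := h4
      obtain ⟨hab, hF, ⟨hau, hav, hua⟩, ⟨hbu, hbv, hvb⟩⟩ := h4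
      simp only at h1 h2 h3 h5 hab hF hau hav hua hbu hbv hvb
      simp only [B, regWith, Finset.coe_sigma, Set.mem_sigma_iff, Finset.coe_filter,
        Set.mem_ofPred_eq, mem_regGraphs, Finset.coe_product, Set.mem_prod, Finset.mem_univ,
        true_and]
      refine ⟨⟨fun w => ?_, fun e hee => ?_⟩, ?_, ?_⟩
      · rw [switch_regular G F u v a b h2 h5, h1]
      · have h6 := h3 e hee
        induction e using Sym2.ind with
        | _ x y =>
        refine ⟨SimpleGraph.ne_of_adj _ h6, Or.inl ⟨h6, ?_, ?_⟩⟩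
        · intro hh; rw [hh] at hee; exact he hee
        · intro hh; rw [hh] at hee; exact hF hee
      · exact ⟨hau.symm, Or.inr (Or.inl rfl)⟩
      · exact ⟨hbv.symm, Or.inr (Or.inr rfl)⟩
    · intro x hx y hy hxy
      obtain ⟨h1, h2, h3, h4⟩ := key x hx
      obtain ⟨h1', h2', h3', h4'⟩ := key y hy
      obtain ⟨G, a, b⟩ := x
      obtain ⟨G', a', b'⟩ := y
      simp only [Sigma.mk.injEq, heq_eq_eq, Prod.mk.injEq] at hxy
      obtain ⟨e1, rfl, rfl⟩ := hxy
      have := switch_inj G G' F u v a b h2 h4 h2' h4' e1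
      rw [this]
  nlinarith

lemma regWith_bound {n : ℕ} (hn : 48 ≤ n) (F : Finset (Sym2 (Fin n))) (hF : 2 * F.card ≤ n) :
    (regWith n F).card * n ^ F.card ≤ 8 ^ F.card * (regGraphs n).card := by
  induction F using Finset.induction_on with
  | empty => simp [regWith]
  | insert e F he ih =>
    rw [Finset.card_insert_of_notMem he] at *
    have h1 := switching F e he (by omega) hn
    have h2 := ih (by omega)
    calc _ = ((regWith n (insert e F)).card * n) * n ^ F.card := by ring
      _ ≤ (8 * (regWith n F).card) * n ^ F.card := by gcongr
      _ = 8 * ((regWith n F).card * n ^ F.card) := by ring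
      _ ≤ 8 * (8 ^ F.card * (regGraphs n).card) := by gcongr
      _ = _ := by ring

end Switching

section Counting
open scoped Classical

/-- `G` has at least `m` edges inside `W`. -/
def HasEdges {V : Type*} (G : SimpleGraph V) (W : Finset V) (m : ℕ) : Prop :=
  ∃ F : Finset (Sym2 V), F ⊆ W.sym2 ∧ F.card = m ∧ (F : Set (Sym2 V)) ⊆ G.edgeSet

lemma hasEdges_count {n : ℕ} (hn : 48 ≤ n) (W : Finset (Fin n)) (m : ℕ) (hm : 2 * m ≤ n) :
    (((regGraphs n).filter (fun G => HasEdges G W m)).card : ℝ) ≤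
      ((W.card + 1).choose 2).choose m * (8 / n : ℝ) ^ m * (regGraphs n).card := by
  have hn0 : (0 : ℝ) < n := by exact_mod_cast (by omega : 0 < n)
  have h1 : (regGraphs n).filter (fun G => HasEdges G W m) ⊆
      (W.sym2.powersetCard m).biUnion (fun F => regWith n F) := by
    intro G hG
    obtain ⟨hG, F, hF1, hF2, hF3⟩ := Finset.mem_filter.1 hG
    simp only [Finset.mem_biUnion, Finset.mem_powersetCard]
    exact ⟨F, ⟨hF1, hF2⟩, Finset.mem_filter.2 ⟨hG, hF3⟩⟩
  have h2 : (((regGraphs n).filter (fun G => HasEdges G W m)).card : ℝ) ≤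
      ∑ F ∈ W.sym2.powersetCard m, ((regWith n F).card : ℝ) := by
    exact_mod_cast (Finset.card_le_card h1).trans Finset.card_biUnion_le
  refine h2.trans ?_
  have h3 : ∀ F ∈ W.sym2.powersetCard m, ((regWith n F).card : ℝ) ≤
      (8 / n : ℝ) ^ m * (regGraphs n).card := by
    intro F hF
    obtain ⟨-, hF⟩ := Finset.mem_powersetCard.1 hF
    have := regWith_bound hn F (by omega)
    rw [hF] at this
    rw [div_pow, div_mul_eq_mul_div, le_div_iff₀ (by positivity)]
    exact_mod_cast this
  refine (Finset.sum_le_sum h3).trans ?_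
  rw [Finset.sum_const, Finset.card_powersetCard, Finset.card_sym2, nsmul_eq_mul]
  apply le_of_eq
  ring

lemma hasEdges_of_minDegree {V : Type*} [Fintype V] (G : SimpleGraph V) (W : Finset V)
    (h : ∀ v ∈ W, 3 ≤ (W.filter (fun x => G.Adj v x)).card) :
    HasEdges G W ((3 * W.card + 1) / 2) := by
  let E : Finset (Sym2 V) := W.sym2.filter (fun e => e ∈ G.edgeSet)
  let P : Finset (V × V) := (W ×ˢ W).filter (fun ab => G.Adj ab.1 ab.2)
  have hP : 3 * W.card ≤ P.card := by
    rw [Finset.card_filter, Finset.sum_product, mul_comm, ← smul_eq_mul, ← Finset.sum_const]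
    apply Finset.sum_le_sum
    intro v hv
    rw [← Finset.card_filter]
    exact h v hv
  have hE : P.card ≤ 2 * E.card := by
    have : P ⊆ E.biUnion (fun e => Finset.univ.filter (fun ab : V × V => s(ab.1, ab.2) = e)) := by
      rintro ⟨a, b⟩ hab
      simp [P] at hab
      simp [E, hab]
    refine (Finset.card_le_card this).trans ?_
    rw [mul_comm]
    apply Finset.card_biUnion_le_card_mul
    intro e _
    induction e using Sym2.ind with
    | _ x y =>
      refine le_trans (Finset.card_le_card (t := {(x,y),(y,x)}) ?_) Finset.card_le_two
      rintro ⟨c, d⟩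
      simp
  obtain ⟨F, hF1, hF2⟩ := Finset.exists_subset_card_eq (s := E) (n := (3 * W.card + 1) / 2) (by omega)
  refine ⟨F, hF1.trans (Finset.filter_subset _ _), hF2, ?_⟩
  intro e he
  exact (Finset.mem_filter.1 (hF1 he)).2

lemma choose_le_three (a b : ℕ) (hb : 0 < b) : (a.choose b : ℝ) ≤ (3 * a / b : ℝ) ^ b := by
  have h1 : (a.choose b : ℝ) ≤ (a : ℝ) ^ b / b.factorial := Nat.choose_le_pow_div b a
  refine h1.trans ?_
  have hb' : (0 : ℝ) < b := by exact_mod_cast hb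
  have h2 : (b : ℝ) ^ b / b.factorial ≤ Real.exp b := Real.pow_div_factorial_le_exp _ hb'.le _
  have h3 : Real.exp b ≤ 3 ^ b := by
    rw [← mul_one (b : ℝ), Real.exp_nat_mul]
    gcongr
    exact (Real.exp_one_lt_d9.trans (by norm_num)).le
  have h4 : (b : ℝ) ^ b ≤ 3 ^ b * b.factorial := by
    have := h2.trans h3
    rwa [div_le_iff₀ (by positivity)] at this
  rw [div_pow, mul_pow, div_le_div_iff₀ (by positivity) (by positivity)]
  nlinarith [pow_pos hb' b, pow_nonneg (Nat.cast_nonneg (α := ℝ) a) b]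

lemma small_term (n u : ℕ) (hu : 0 < u) (hn : 147456 * u ≤ n) :
    (n.choose u : ℝ) * (((u + 1).choose 2).choose ((3 * u + 1) / 2) *
      (8 / n : ℝ) ^ ((3 * u + 1) / 2)) ≤ 384 / Real.sqrt n * (u / 2 ^ u) := by
  set m := (3 * u + 1) / 2 with hm
  have hm1 : 3 * u ≤ 2 * m := by omega
  have hm0 : 0 < m := by omega
  have hu' : (1 : ℝ) ≤ u := by exact_mod_cast hu
  have hm' : (0 : ℝ) < m := by exact_mod_cast hm0
  have hm1' : 3 * (u : ℝ) ≤ 2 * m := by exact_mod_cast hm1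
  have hn' : 147456 * (u : ℝ) ≤ n := by exact_mod_cast hn
  have hn0 : (0 : ℝ) < n := by linarith
  have e1 := choose_le_three n u hu
  have e2 : ((((u + 1).choose 2).choose m : ℕ) : ℝ) ≤ (2 * u : ℝ) ^ m := by
    refine (choose_le_three _ _ hm0).trans ?_
    have : (((u + 1).choose 2 : ℕ) : ℝ) = (u + 1) * u / 2 := by
      rw [Nat.cast_choose_two]; push_cast; ring
    rw [this]
    gcongr
    rw [div_le_iff₀ hm']
    nlinarith
  have e3 : (n.choose u : ℝ) * (((u + 1).choose 2).choose m * (8 / n : ℝ) ^ m) ≤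
      (3 * n / u : ℝ) ^ u * (16 * u / n : ℝ) ^ m := by
    calc _ ≤ (3 * n / u : ℝ) ^ u * ((2 * u : ℝ) ^ m * (8 / n : ℝ) ^ m) := by gcongr
      _ = _ := by
        rw [← mul_pow]
        congr 2
        ring
  refine e3.trans ?_
  refine (pow_le_pow_iff_left₀ (by positivity) (by positivity) (two_ne_zero)).1 ?_
  have e4 : ((16 * u / n : ℝ) ^ m) ^ 2 ≤ (16 * u / n : ℝ) ^ (3 * u) := by
    rw [← pow_mul, mul_comm m 2]
    apply pow_le_pow_of_le_one (by positivity) _ hm1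
    rw [div_le_one hn0]
    linarith
  have e5 : ((3 * n / u : ℝ) ^ u * (16 * u / n : ℝ) ^ m) ^ 2 ≤ (36864 * u / n : ℝ) ^ u := by
    rw [mul_pow]
    calc _ ≤ ((3 * n / u : ℝ) ^ u) ^ 2 * (16 * u / n : ℝ) ^ (3 * u) := by gcongr
      _ = _ := by
        rw [← pow_mul, mul_comm u 2, pow_mul, pow_mul, ← mul_pow]
        congr 1
        field_simp
        norm_num
  refine e5.trans ?_
  obtain ⟨k, rfl⟩ : ∃ k, u = k + 1 := ⟨u - 1, by omega⟩
  have e6 : (36864 * ((k + 1 : ℕ) : ℝ) / n) ≤ 1 / 4 := by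
    rw [div_le_div_iff₀ hn0 (by norm_num)]
    linarith
  rw [pow_succ]
  calc _ ≤ (1 / 4 : ℝ) ^ k * (36864 * ((k + 1 : ℕ) : ℝ) / n) := by gcongr
    _ ≤ _ := by
      rw [mul_pow, div_pow (384 : ℝ), div_pow ((k + 1 : ℕ) : ℝ), Real.sq_sqrt hn0.le]
      have : ((2 : ℝ) ^ (k + 1)) ^ 2 = 4 * 4 ^ k := by
        rw [← pow_mul, mul_comm, pow_mul]; norm_num [pow_succ]; ring
      rw [this, one_div, inv_pow]
      have h4 : (0 : ℝ) < 4 ^ k := by positivity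
      have h5 : (384 : ℝ) ^ 2 / n * (((k + 1 : ℕ) : ℝ) ^ 2 / (4 * 4 ^ k)) =
        ((4 : ℝ) ^ k)⁻¹ * (36864 * (((k + 1 : ℕ) : ℝ) * ((k + 1 : ℕ) : ℝ)) / n) := by
        field_simp
        norm_num
      rw [h5]
      gcongr
      nlinarith

lemma sum_bound (K : ℕ) : ∑ u ∈ Finset.range K, ((u : ℝ) / 2 ^ u) ≤ 2 := by
  have : ∀ K : ℕ, ∑ u ∈ Finset.range K, ((u : ℝ) / 2 ^ u) = 2 - 2 * (K + 1) / 2 ^ K := by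
    intro K
    induction K with
    | zero => simp
    | succ K ih =>
      rw [Finset.sum_range_succ, ih]
      push_cast
      field_simp
      ring
  rw [this]
  have : (0 : ℝ) ≤ 2 * (K + 1) / 2 ^ K := by positivity
  linarith

/-- small set with minimum degree at least three -/
def SmallCore {n : ℕ} (G : SimpleGraph (Fin n)) : Prop :=
  ∃ W : Finset (Fin n), W.Nonempty ∧ 147456 * W.card ≤ n ∧
    ∀ v ∈ W, 3 ≤ (W.filter (fun x => G.Adj v x)).card

lemma smallCore_count {n : ℕ} (hn : 48 ≤ n) :
    (((regGraphs n).filter (fun G => SmallCore G)).card : ℝ) ≤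
      768 / Real.sqrt n * (regGraphs n).card := by
  let R := (Finset.range (n + 1)).filter (fun u => 0 < u ∧ 147456 * u ≤ n)
  have h1 : (regGraphs n).filter (fun G => SmallCore G) ⊆
      R.biUnion (fun u => ((Finset.univ : Finset (Fin n)).powersetCard u).biUnion
        (fun W => (regGraphs n).filter (fun G => HasEdges G W ((3 * W.card + 1) / 2)))) := by
    intro G hG
    obtain ⟨hG, W, hW1, hW2, hW3⟩ := Finset.mem_filter.1 hG
    simp only [Finset.mem_biUnion, Finset.mem_powersetCard, Finset.mem_filter, R, Finset.mem_range]
    refine ⟨W.card, ⟨by omega, hW1.card_pos, hW2⟩, W, ⟨Finset.subset_univ _, rfl⟩, hG, ?_⟩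
    exact hasEdges_of_minDegree G W hW3
  have h2 : (((regGraphs n).filter (fun G => SmallCore G)).card : ℝ) ≤
      ∑ u ∈ R, ∑ W ∈ (Finset.univ : Finset (Fin n)).powersetCard u,
        (((regGraphs n).filter (fun G => HasEdges G W ((3 * W.card + 1) / 2))).card : ℝ) := by
    have := (Finset.card_le_card h1).trans (Finset.card_biUnion_le.trans
      (Finset.sum_le_sum fun u _ => Finset.card_biUnion_le))
    exact_mod_cast this
  refine h2.trans ?_
  have h3 : ∀ u ∈ R, ∑ W ∈ (Finset.univ : Finset (Fin n)).powersetCard u,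
        (((regGraphs n).filter (fun G => HasEdges G W ((3 * W.card + 1) / 2))).card : ℝ) ≤
        384 / Real.sqrt n * (u / 2 ^ u) * (regGraphs n).card := by
    intro u hu
    obtain ⟨-, hu0, hu1⟩ := Finset.mem_filter.1 hu
    have h4 : ∀ W ∈ (Finset.univ : Finset (Fin n)).powersetCard u,
        (((regGraphs n).filter (fun G => HasEdges G W ((3 * W.card + 1) / 2))).card : ℝ) ≤
        ((u + 1).choose 2).choose ((3 * u + 1) / 2) *
          (8 / n : ℝ) ^ ((3 * u + 1) / 2) * (regGraphs n).card := by
      intro W hW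
      have hW := (Finset.mem_powersetCard.1 hW).2
      have := hasEdges_count hn W ((3 * W.card + 1) / 2) (by omega)
      rwa [hW] at this ⊢
    refine (Finset.sum_le_sum h4).trans ?_
    rw [Finset.sum_const, Finset.card_powersetCard, Finset.card_univ, Fintype.card_fin,
      nsmul_eq_mul, ← mul_assoc]
    exact mul_le_mul_of_nonneg_right (small_term n u hu0 hu1) (Nat.cast_nonneg _)
  refine (Finset.sum_le_sum h3).trans ?_
  rw [← Finset.sum_mul, ← Finset.mul_sum]
  have h5 : ∑ u ∈ R, ((u : ℝ) / 2 ^ u) ≤ 2 := by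
    refine le_trans (Finset.sum_le_sum_of_subset_of_nonneg (Finset.filter_subset _ _) ?_)
      (sum_bound (n + 1))
    intros; positivity
  have h6 : 768 / Real.sqrt n = 384 / Real.sqrt n * 2 := by ring
  rw [h6]
  gcongr

/-- `v` lies in a small set spanning at least as many edges as vertices -/
def BadVertex {n : ℕ} (K : ℕ) (G : SimpleGraph (Fin n)) (v : Fin n) : Prop :=
  ∃ W : Finset (Fin n), v ∈ W ∧ W.card ≤ K ∧ HasEdges G W W.card

lemma badVertex_count (K : ℕ) : ∃ C : ℝ, ∀ n : ℕ, 48 ≤ n → 2 * K ≤ n →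
    ∑ v : Fin n, (((regGraphs n).filter (fun G => BadVertex K G v)).card : ℝ) ≤
      C * (regGraphs n).card := by
  refine ⟨∑ k ∈ Finset.range (K + 1), (k : ℝ) * (((k + 1).choose 2).choose k * 8 ^ k), ?_⟩
  intro n hn hK
  have hn0 : (0 : ℝ) < n := by exact_mod_cast (by omega : 0 < n)
  have h1 : ∀ v : Fin n, (((regGraphs n).filter (fun G => BadVertex K G v)).card : ℝ) ≤
      ∑ k ∈ Finset.range (K + 1), ∑ W ∈ (Finset.univ : Finset (Fin n)).powersetCard k,
        if v ∈ W then (((regGraphs n).filter (fun G => HasEdges G W W.card)).card : ℝ) else 0 := by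
    intro v
    have hsub : (regGraphs n).filter (fun G => BadVertex K G v) ⊆
        (Finset.range (K + 1)).biUnion (fun k =>
          ((Finset.univ : Finset (Fin n)).powersetCard k).biUnion
          (fun W => if v ∈ W then (regGraphs n).filter (fun G => HasEdges G W W.card) else ∅)) := by
      intro G hG
      obtain ⟨hG, W, hW1, hW2, hW3⟩ := Finset.mem_filter.1 hG
      simp only [Finset.mem_biUnion, Finset.mem_powersetCard, Finset.mem_range]
      refine ⟨W.card, by omega, W, ⟨Finset.subset_univ _, rfl⟩, ?_⟩
      rw [if_pos hW1]
      exact Finset.mem_filter.2 ⟨hG, hW3⟩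
    have := (Finset.card_le_card hsub).trans (Finset.card_biUnion_le.trans
      (Finset.sum_le_sum fun u _ => Finset.card_biUnion_le))
    refine (Nat.cast_le (α := ℝ).2 this).trans (le_of_eq ?_)
    push_cast
    refine Finset.sum_congr rfl fun k _ => Finset.sum_congr rfl fun W _ => ?_
    split_ifs <;> simp
  refine (Finset.sum_le_sum fun v _ => h1 v).trans ?_
  rw [Finset.sum_comm, Finset.sum_mul]
  apply Finset.sum_le_sum
  intro k hk
  have hk : k ≤ K := by simpa [Nat.lt_succ_iff] using hk
  rw [Finset.sum_comm]
  have h2 : ∀ W ∈ (Finset.univ : Finset (Fin n)).powersetCard k,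
      (∑ v : Fin n, if v ∈ W then
        (((regGraphs n).filter (fun G => HasEdges G W W.card)).card : ℝ) else 0) ≤
      k * (((k + 1).choose 2).choose k * (8 / n : ℝ) ^ k * (regGraphs n).card) := by
    intro W hW
    have hW := (Finset.mem_powersetCard.1 hW).2
    rw [← Finset.sum_filter, Finset.sum_const, nsmul_eq_mul]
    have h3 : (Finset.univ.filter (fun v => v ∈ W)) = W := by ext; simp
    rw [h3, hW]
    gcongr
    have := hasEdges_count hn W W.card (by omega)
    rwa [hW] at this
  refine (Finset.sum_le_sum h2).trans ?_
  rw [Finset.sum_const, Finset.card_powersetCard, Finset.card_univ, Fintype.card_fin,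
      nsmul_eq_mul]
  have h4 : (n.choose k : ℝ) * (8 / n : ℝ) ^ k ≤ 8 ^ k := by
    have : (n.choose k : ℝ) ≤ n ^ k := by exact_mod_cast Nat.choose_le_pow n k
    calc _ ≤ (n : ℝ) ^ k * (8 / n : ℝ) ^ k := by gcongr
      _ = _ := by rw [← mul_pow]; congr 1; field_simp
  calc _ = k * (((k + 1).choose 2).choose k * ((n.choose k : ℝ) * (8 / n : ℝ) ^ k)) *
        (regGraphs n).card := by ring
    _ ≤ _ := by gcongr

end Counting

section Tree
open scoped Classical

/-- `v` is not activated within `t` rounds through `H` without the help of `w`. -/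
def DirUn {V : Type*} (H : SimpleGraph V) (S : Set V) : ℕ → V → V → Prop
  | 0, v, _ => v ∉ S
  | t + 1, v, w => v ∉ S ∧ ¬ ∃ x y, x ≠ y ∧ (H.Adj v x ∧ x ≠ w) ∧ (H.Adj v y ∧ y ≠ w) ∧
      ¬ DirUn H S t x v ∧ ¬ DirUn H S t y v

/-- the vertices relevant for `DirUn`. -/
def DirBall {V : Type*} (H : SimpleGraph V) : ℕ → V → V → Set V
  | 0, v, _ => {v}
  | t + 1, v, w => {z | z = v ∨ ∃ x, (H.Adj v x ∧ x ≠ w) ∧ z ∈ DirBall H t x v}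

/-- degrees are large enough -/
def DirFull {V : Type*} (H : SimpleGraph V) : ℕ → V → V → Prop
  | 0, _, _ => True
  | t + 1, v, w => (∃ x y z, x ≠ y ∧ x ≠ z ∧ y ≠ z ∧ (H.Adj v x ∧ x ≠ w) ∧ (H.Adj v y ∧ y ≠ w) ∧
      (H.Adj v z ∧ z ≠ w)) ∧ ∀ x, H.Adj v x → x ≠ w → DirFull H t x v

lemma subset_iterate {V : Type*} (G : SimpleGraph V) (S : Set V) (t : ℕ) :
    S ⊆ (colorStep G)^[t] S := by
  induction t with
  | zero => simp
  | succ t ih =>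
    rw [Function.iterate_succ_apply']
    exact ih.trans Set.subset_union_left

lemma dirUn_of_not_mem {V : Type*} (G H : SimpleGraph V) (hle : H ≤ G) (S : Set V) (t : ℕ) :
    ∀ v w, v ∉ (colorStep G)^[t] S → DirUn H S t v w := by
  induction t with
  | zero => intro v w h; simpa [DirUn] using h
  | succ t ih =>
    intro v w h
    refine ⟨fun hv => h (subset_iterate G S _ hv), ?_⟩
    rintro ⟨x, y, hxy, hx, hy, hDx, hDy⟩
    apply h
    rw [Function.iterate_succ_apply']
    right
    refine ⟨x, y, hxy, hle hx.1, hle hy.1, ?_, ?_⟩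
    · by_contra hc; exact hDx (ih _ _ hc)
    · by_contra hc; exact hDy (ih _ _ hc)

lemma dirBall_path {V : Type*} (H : SimpleGraph V) (hH : H.IsAcyclic) (t : ℕ) :
    ∀ v x z, H.Adj v x → z ∈ DirBall H t x v → ∃ p : H.Walk x z, p.IsPath ∧ v ∉ p.support := by
  induction t with
  | zero =>
    intro v x z hvx hz
    have : z = x := hz
    subst this
    exact ⟨SimpleGraph.Walk.nil, by simp, by simp [hvx.ne]⟩
  | succ t ih =>
    intro v x z hvx hz
    rcases hz with rfl | ⟨y, ⟨hxy, hyv⟩, hz⟩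
    · exact ⟨SimpleGraph.Walk.nil, by simp, by simp [hvx.ne]⟩
    · obtain ⟨q, hq, hxq⟩ := ih x y z hxy hz
      refine ⟨SimpleGraph.Walk.cons hxy q, hq.cons hxq, ?_⟩
      intro hv
      rw [SimpleGraph.Walk.support_cons, List.mem_cons] at hv
      rcases hv with hv | hv
      · exact hvx.ne hv
      · have h1 : (SimpleGraph.Walk.cons hxy (q.takeUntil v hv)).IsPath :=
          (hq.takeUntil hv).cons (fun h => hxq (q.support_takeUntil_subset_support hv h))
        have h2 : (SimpleGraph.Walk.cons hvx.symm SimpleGraph.Walk.nil).IsPath := by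
          simp [hvx.ne.symm]
        have h3 := (hH.subsingleton_path _ _).elim ⟨_, h1⟩ ⟨_, h2⟩
        have h4 := congrArg (fun p => p.1.snd) h3
        simp at h4
        exact hyv h4

lemma dirBall_disjoint {V : Type*} (H : SimpleGraph V) (hH : H.IsAcyclic) (t : ℕ)
    (v x y : V) (hx : H.Adj v x) (hy : H.Adj v y) (hxy : x ≠ y) :
    Disjoint (DirBall H t x v) (DirBall H t y v) := by
  rw [Set.disjoint_left]
  intro z hzx hzy
  obtain ⟨p, hp, hvp⟩ := dirBall_path H hH t v x z hx hzx
  obtain ⟨q, hq, hvq⟩ := dirBall_path H hH t v y z hy hzy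
  have h3 := (hH.subsingleton_path _ _).elim ⟨_, hp.cons (h := hx) hvp⟩ ⟨_, hq.cons (h := hy) hvq⟩
  have h4 := congrArg (fun p => p.1.snd) h3
  simp at h4
  exact hxy h4

lemma dirBall_not_mem {V : Type*} (H : SimpleGraph V) (hH : H.IsAcyclic) (t : ℕ)
    (v x : V) (hx : H.Adj v x) : v ∉ DirBall H t x v := by
  intro h
  obtain ⟨p, hp, hvp⟩ := dirBall_path H hH t v x v hx h
  exact hvp p.end_mem_support

/-- The event `A` depends only on coordinates in `B`. -/
def Dep {V : Type*} (A : Set (V → Bool)) (B : Set V) : Prop :=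
  ∀ f g, (∀ x ∈ B, f x = g x) → (f ∈ A → g ∈ A)

lemma Dep.inter {V : Type*} {A A' : Set (V → Bool)} {B B' : Set V} (h : Dep A B) (h' : Dep A' B') :
    Dep (A ∩ A') (B ∪ B') := fun f g hfg hf =>
  ⟨h f g (fun x hx => hfg x (Or.inl hx)) hf.1, h' f g (fun x hx => hfg x (Or.inr hx)) hf.2⟩

lemma Dep.union {V : Type*} {A A' : Set (V → Bool)} {B B' : Set V} (h : Dep A B) (h' : Dep A' B') :
    Dep (A ∪ A') (B ∪ B') := fun f g hfg hf =>
  hf.imp (h f g (fun x hx => hfg x (Or.inl hx))) (h' f g (fun x hx => hfg x (Or.inr hx)))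

lemma Dep.compl {V : Type*} {A : Set (V → Bool)} {B : Set V} (h : Dep A B) :
    Dep Aᶜ B := fun f g hfg hf hg => hf (h g f (fun x hx => (hfg x hx).symm) hg)

lemma dirUn_congr {V : Type*} (H : SimpleGraph V) (S S' : Set V) (t : ℕ) :
    ∀ v w, (∀ x ∈ DirBall H t v w, x ∈ S ↔ x ∈ S') → (DirUn H S t v w ↔ DirUn H S' t v w) := by
  induction t with
  | zero =>
    intro v w h
    have := h v rfl
    simp only [DirUn, this]
  | succ t ih =>
    intro v w h
    have hv := h v (Or.inl rfl)
    have hx : ∀ x, (H.Adj v x ∧ x ≠ w) → (DirUn H S t x v ↔ DirUn H S' t x v) := fun x hx =>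
      ih x v (fun z hz => h z (Or.inr ⟨x, hx, hz⟩))
    simp only [DirUn, hv]
    grind

lemma dirUn_dep {V : Type*} (H : SimpleGraph V) (t : ℕ) (v w : V) :
    Dep {f : V → Bool | DirUn H {v | f v = true} t v w} (DirBall H t v w) := by
  intro f g hfg hf
  refine (dirUn_congr H _ _ t v w ?_).1 hf
  intro x hx
  change f x = true ↔ g x = true
  rw [hfg x hx]

variable {V : Type*} [Fintype V]

lemma bernoulli_prob (p : ℝ) (h0 : 0 ≤ p) (h1 : p ≤ 1) :
    IsProbabilityMeasure (bernoulliMeasure p) := by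
  constructor
  simp only [bernoulliMeasure, Measure.coe_add, Measure.coe_smul, Pi.add_apply, Pi.smul_apply,
    measure_univ, smul_eq_mul, mul_one]
  rw [← ENNReal.ofReal_add h0 (by linarith)]
  simp

lemma seed_prob (p : ℝ) (h0 : 0 ≤ p) (h1 : p ≤ 1) :
    IsProbabilityMeasure (seedMeasure V p) := by
  have := bernoulli_prob p h0 h1
  unfold seedMeasure
  infer_instance

lemma all_meas (A : Set (V → Bool)) : MeasurableSet A := A.toFinite.measurableSet

lemma dep_indep (p : ℝ) (h0 : 0 ≤ p) (h1 : p ≤ 1) {A A' : Set (V → Bool)} {B B' : Set V}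
    (h : Dep A B) (h' : Dep A' B') (hB : Disjoint B B') :
    (seedMeasure V p).real (A ∩ A') = (seedMeasure V p).real A * (seedMeasure V p).real A' := by
  have := bernoulli_prob p h0 h1
  have hi : ProbabilityTheory.iIndepFun (fun (i : V) (ω : V → Bool) => ω i) (seedMeasure V p) :=
    ProbabilityTheory.iIndepFun_pi (X := fun _ x => x) (fun i => aemeasurable_id)
  have h2 := hi.indepFun_finset B.toFinset B'.toFinset (by simpa using hB)
    (fun i => measurable_pi_apply i)
  have key : ∀ (A : Set (V → Bool)) (B : Set V), Dep A B →
      A = (fun (a : V → Bool) (i : B.toFinset) => a i) ⁻¹'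
        ((fun (a : V → Bool) (i : B.toFinset) => a i) '' A) := by
    intro A B h
    apply Set.Subset.antisymm (Set.subset_preimage_image _ _)
    rintro g ⟨f, hf, hfg⟩
    refine h f g ?_ hf
    intro x hx
    exact congrFun hfg ⟨x, by simpa using hx⟩
  have h3 := ProbabilityTheory.indepFun_iff_measure_inter_preimage_eq_mul.1 h2 _ _
    ((fun (a : V → Bool) (i : B.toFinset) => a i) '' A).toFinite.measurableSet
    ((fun (a : V → Bool) (i : B'.toFinset) => a i) '' A').toFinite.measurableSet
  rw [← key A B h, ← key A' B' h'] at h3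
  simp only [Measure.real, h3, ENNReal.toReal_mul]

lemma seed_false (p : ℝ) (h0 : 0 ≤ p) (h1 : p ≤ 1) (v : V) :
    (seedMeasure V p).real {f | f v = false} = 1 - p := by
  have := bernoulli_prob p h0 h1
  have h2 := (measurePreserving_eval (fun _ : V => bernoulliMeasure p) v).measure_preimage
    (s := {false}) (by measurability)
  have h3 : {f : V → Bool | f v = false} = (Function.eval v : (V → Bool) → Bool) ⁻¹' {false} := by ext; simp
  rw [Measure.real, h3, seedMeasure, h2]
  simp [bernoulliMeasure, h1]

lemma maj_bound (p : ℝ) (h0 : 0 ≤ p) (h1 : p ≤ 1) {A1 A2 A3 : Set (V → Bool)} {B1 B2 B3 : Set V}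
    (d1 : Dep A1 B1) (d2 : Dep A2 B2) (d3 : Dep A3 B3)
    (h12 : Disjoint B1 B2) (h13 : Disjoint B1 B3) (h23 : Disjoint B2 B3) (y : ℝ) (hy : y ≤ 1)
    (l1 : (seedMeasure V p).real A1 ≤ y) (l2 : (seedMeasure V p).real A2 ≤ y)
    (l3 : (seedMeasure V p).real A3 ≤ y) :
    (seedMeasure V p).real (((A1 ∪ A2) ∩ A3) ∪ ((A1 ∩ A2) ∩ A3ᶜ)) ≤ 3 * y ^ 2 - 2 * y ^ 3 := by
  have := seed_prob (V := V) p h0 h1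
  have e1 := dep_indep p h0 h1 (d1.union d2) d3 (by simp [h13, h23])
  have e2 := dep_indep p h0 h1 (d1.inter d2) d3.compl (by simp [h13, h23])
  have e3 := dep_indep p h0 h1 d1 d2 h12
  have e4 := measureReal_union_add_inter (μ := seedMeasure V p) (s := A1) (t := A2) (all_meas _)
  have e5 := probReal_compl_eq_one_sub (μ := seedMeasure V p) (s := A3) (all_meas _)
  refine (measureReal_union_le _ _).trans ?_
  rw [e1, e2, e3, e5]
  rw [e3] at e4
  have e6 : (seedMeasure V p).real (A1 ∪ A2) = (seedMeasure V p).real A1 +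
    (seedMeasure V p).real A2 - (seedMeasure V p).real A1 * (seedMeasure V p).real A2 := by
    linarith
  rw [e6]
  have n1 : 0 ≤ (seedMeasure V p).real A1 := measureReal_nonneg
  have n2 : 0 ≤ (seedMeasure V p).real A2 := measureReal_nonneg
  have n3 : 0 ≤ (seedMeasure V p).real A3 := measureReal_nonneg
  generalize (seedMeasure V p).real A1 = a at *
  generalize (seedMeasure V p).real A2 = b at *
  generalize (seedMeasure V p).real A3 = c at *
  have mono : ∀ a b c y : ℝ, 0 ≤ b → b ≤ 1 → 0 ≤ c → c ≤ 1 → a ≤ y →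
      a * b + a * c + b * c - 2 * (a * b * c) ≤ y * b + y * c + b * c - 2 * (y * b * c) := by
    intro a b c y hb hb1 hc hc1 hay
    have h1 : 0 ≤ b * (1 - c) + c * (1 - b) := by
      have := mul_nonneg hb (sub_nonneg.2 hc1)
      have := mul_nonneg hc (sub_nonneg.2 hb1)
      linarith
    nlinarith [mul_nonneg (sub_nonneg.2 hay) h1]
  have m1 := mono a b c y n2 (by linarith) n3 (by linarith) l1
  have m2 := mono b y c y (by linarith) hy n3 (by linarith) l2
  have m3 := mono c y y y (by linarith) hy (by linarith) hy l3
  nlinarith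

lemma dirUn_prob (p : ℝ) (hp1 : 0.12 ≤ p) (hp2 : p ≤ 1) (H : SimpleGraph V) (hH : H.IsAcyclic)
    (t : ℕ) : ∀ v w, DirFull H t v w →
    (seedMeasure V p).real {f | DirUn H {v | f v = true} t v w} ≤ 0.99 ^ t := by
  have h0 : 0 ≤ p := by norm_num at hp1; linarith
  have := seed_prob (V := V) p h0 hp2
  induction t with
  | zero => intro v w _; simp
  | succ t ih =>
    intro v w hfull
    obtain ⟨⟨x, y, z, hxy, hxz, hyz, hx, hy, hz⟩, hrec⟩ := hfull
    set A : V → Set (V → Bool) := fun x => {f | DirUn H {v | f v = true} t x v} with hA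
    have hdep : ∀ x, Dep (A x) (DirBall H t x v) := fun x => dirUn_dep H t x v
    have hsub : {f : V → Bool | DirUn H {v | f v = true} (t + 1) v w} ⊆
        {f | f v = false} ∩ (((A x ∪ A y) ∩ A z) ∪ ((A x ∩ A y) ∩ (A z)ᶜ)) := by
      intro f hf
      obtain ⟨hf1, hf2⟩ := hf
      refine ⟨by simpa using hf1, ?_⟩
      have m : ∀ x, f ∈ A x ↔ DirUn H {v | f v = true} t x v := fun x => Iff.rfl
      have g1 : f ∈ A x ∨ f ∈ A y := by
        by_contra hc; push Not at hc
        exact hf2 ⟨x, y, hxy, hx, hy, hc.1, hc.2⟩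
      have g2 : f ∈ A x ∨ f ∈ A z := by
        by_contra hc; push Not at hc
        exact hf2 ⟨x, z, hxz, hx, hz, hc.1, hc.2⟩
      have g3 : f ∈ A y ∨ f ∈ A z := by
        by_contra hc; push Not at hc
        exact hf2 ⟨y, z, hyz, hy, hz, hc.1, hc.2⟩
      simp only [Set.mem_union, Set.mem_inter_iff, Set.mem_compl_iff]
      tauto
    have hd0 : Dep {f : V → Bool | f v = false} {v} := by
      intro f g hfg hf
      change g v = false
      rw [← hfg v rfl]; exact hf
    have hd1 : Dep (((A x ∪ A y) ∩ A z) ∪ ((A x ∩ A y) ∩ (A z)ᶜ)) _ :=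
      (((hdep x).union (hdep y)).inter (hdep z)).union
        (((hdep x).inter (hdep y)).inter (hdep z).compl)
    have hind := dep_indep p h0 hp2 hd0 hd1 (by
      simp [dirBall_not_mem H hH t v _ hx.1, dirBall_not_mem H hH t v _ hy.1,
        dirBall_not_mem H hH t v _ hz.1])
    have hy1 : (0.99 : ℝ) ^ t ≤ 1 := pow_le_one₀ (by norm_num) (by norm_num)
    have hy0 : (0 : ℝ) ≤ 0.99 ^ t := by positivity
    have hmaj := maj_bound p h0 hp2 (hdep x) (hdep y) (hdep z)
      (dirBall_disjoint H hH t v x y hx.1 hy.1 hxy) (dirBall_disjoint H hH t v x z hx.1 hz.1 hxz)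
      (dirBall_disjoint H hH t v y z hy.1 hz.1 hyz) (0.99 ^ t) hy1
      (ih x v (hrec x hx.1 hx.2)) (ih y v (hrec y hy.1 hy.2)) (ih z v (hrec z hz.1 hz.2))
    refine (measureReal_mono hsub).trans ?_
    rw [hind, seed_false p h0 hp2, pow_succ]
    generalize (0.99 : ℝ) ^ t = q at *
    have e1 : 0 ≤ 3 * q ^ 2 - 2 * q ^ 3 := by nlinarith [sq_nonneg q]
    calc _ ≤ (1 - p) * (3 * q ^ 2 - 2 * q ^ 3) := by
          apply mul_le_mul_of_nonneg_left hmaj; linarith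
      _ ≤ 0.88 * (3 * q ^ 2 - 2 * q ^ 3) := by
          apply mul_le_mul_of_nonneg_right _ e1; norm_num at hp1 ⊢; linarith
      _ ≤ q * 0.99 := by
          nlinarith [mul_nonneg hy0 (sq_nonneg (q - 3/4))]

end Tree

section Ball
open scoped Classical

/-- closed balls in a finite graph -/
noncomputable def gBall {V : Type*} [Fintype V] (G : SimpleGraph V) (v : V) : ℕ → Finset V
  | 0 => {v}
  | r + 1 => gBall G v r ∪ (gBall G v r).biUnion (fun x => Finset.univ.filter (fun y => G.Adj x y))

lemma gBall_mono {V : Type*} [Fintype V] (G : SimpleGraph V) (v : V) {r s : ℕ} (h : r ≤ s) :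
    gBall G v r ⊆ gBall G v s := by
  induction s, h using Nat.le_induction with
  | base => exact subset_rfl
  | succ s _ ih => exact ih.trans Finset.subset_union_left

lemma gBall_adj {V : Type*} [Fintype V] (G : SimpleGraph V) (v : V) {r : ℕ} {x y : V}
    (hx : x ∈ gBall G v r) (hxy : G.Adj x y) : y ∈ gBall G v (r + 1) := by
  refine Finset.mem_union_right _ (Finset.mem_biUnion.2 ⟨x, hx, by simpa using hxy⟩)

lemma gBall_card_aux {V : Type*} [Fintype V] {G : SimpleGraph V}
    (h : ∀ x, (Finset.univ.filter (fun y => G.Adj x y)).card ≤ 4) (v : V) (r : ℕ) :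
    (gBall G v r).card ≤ 5 ^ r := by
  induction r with
  | zero => simp [gBall]
  | succ r ih =>
    refine (Finset.card_union_le _ _).trans ?_
    have := Finset.card_biUnion_le_card_mul (gBall G v r)
      (fun x => Finset.univ.filter (fun y => G.Adj x y)) 4 (fun x _ => h x)
    rw [pow_succ]
    omega

lemma gBall_card {n : ℕ} {G : SimpleGraph (Fin n)} (h : G ∈ regGraphs n) (v : Fin n) (r : ℕ) :
    (gBall G v r).card ≤ 5 ^ r :=
  gBall_card_aux (fun x => (degree_of_reg h x).le) v r

lemma mem_gBall_self {V : Type*} [Fintype V] (G : SimpleGraph V) (v : V) (r : ℕ) :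
    v ∈ gBall G v r := gBall_mono G v (Nat.zero_le r) (by simp [gBall])

/-- the restriction of `G` to `W`, on the same vertex set -/
def restrictTo {V : Type*} (G : SimpleGraph V) (W : Finset V) : SimpleGraph V where
  Adj x y := G.Adj x y ∧ x ∈ W ∧ y ∈ W
  symm := ⟨fun _ _ h => ⟨h.1.symm, h.2.2, h.2.1⟩⟩
  loopless := ⟨fun _ h => h.1.ne rfl⟩

lemma ball_connected {V : Type*} [Fintype V] (G : SimpleGraph V) (v : V) (R : ℕ) :
    (G.induce (gBall G v R : Set V)).Connected := by
  have key : ∀ r, ∀ hr : r ≤ R, ∀ x, ∀ hx : x ∈ gBall G v r,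
      (G.induce (gBall G v R : Set V)).Reachable ⟨v, mem_gBall_self G v R⟩
        ⟨x, gBall_mono G v hr hx⟩ := by
    intro r
    induction r with
    | zero =>
      intro hr x hx
      have : x = v := by simpa [gBall] using hx
      subst this
      exact SimpleGraph.Reachable.refl _
    | succ r ih =>
      intro hr x hx
      rcases Finset.mem_union.1 hx with h | h
      · exact ih (by omega) x h
      · obtain ⟨y, hy, hyx⟩ := Finset.mem_biUnion.1 h
        have hyx : G.Adj y x := by simpa using hyx
        refine (ih (by omega) y hy).trans (SimpleGraph.Adj.reachable ?_)
        exact hyx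
  have : Nonempty (gBall G v R : Set V) := ⟨⟨v, mem_gBall_self G v R⟩⟩
  refine ⟨?_⟩
  intro x y
  exact (key R le_rfl x.1 x.2).symm.trans (key R le_rfl y.1 y.2)

lemma hasEdges_of_card {V : Type*} [Fintype V] (G : SimpleGraph V) (W : Finset V) (m : ℕ)
    (h : m ≤ Nat.card (G.induce (W : Set V)).edgeSet) : HasEdges G W m := by
  have hc : Nat.card (G.induce (W : Set V)).edgeSet = (G.induce (W : Set V)).edgeFinset.card := by
    rw [Nat.card_eq_fintype_card, SimpleGraph.edgeFinset_card]
  rw [hc] at h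
  obtain ⟨F, hF1, hF2⟩ := Finset.exists_subset_card_eq h
  refine ⟨F.image (Sym2.map Subtype.val), ?_, ?_, ?_⟩
  · intro e he
    obtain ⟨e', he', rfl⟩ := Finset.mem_image.1 he
    induction e' using Sym2.ind with
    | _ x y => simp
  · rw [Finset.card_image_of_injective _ (Sym2.map.injective Subtype.val_injective), hF2]
  · intro e he
    obtain ⟨e', he', rfl⟩ := Finset.mem_image.1 (Finset.mem_coe.1 he)
    have := hF1 he'
    induction e' using Sym2.ind with
    | _ x y => simpa using this

lemma restrict_acyclic {V : Type*} (G : SimpleGraph V) (W : Finset V)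
    (h : (G.induce (W : Set V)).IsAcyclic) : (restrictTo G W).IsAcyclic := by
  have h2 : ((restrictTo G W).induce (W : Set V)).IsAcyclic := by
    refine h.anti ?_
    intro x y hxy
    exact hxy.1
  intro v c hc
  have hs : ∀ x ∈ c.support, x ∈ (W : Set V) := by
    intro x hx
    obtain ⟨y, hy⟩ : ∃ y, (restrictTo G W).Adj x y := by
      obtain ⟨e, he, hxe⟩ := (c.mem_support_iff_exists_mem_edges_of_not_nil hc.not_nil).1 hx
      obtain ⟨y, rfl⟩ := hxe
      exact ⟨y, c.adj_of_mem_edges he⟩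
    exact hy.2.1
  have hm := SimpleGraph.Walk.map_induce c hs
  refine h2 (c.induce _ hs) ?_
  rw [← hm] at hc
  exact (SimpleGraph.Walk.isCycle_map_iff_of_injective Subtype.val_injective).1 hc

lemma restrict_ball_acyclic {n : ℕ} {G : SimpleGraph (Fin n)} (hG : G ∈ regGraphs n) (v : Fin n)
    (R : ℕ) (hb : ¬ BadVertex (5 ^ R) G v) : (restrictTo G (gBall G v R)).IsAcyclic := by
  apply restrict_acyclic
  have hc := ball_connected G v R
  have h1 := hc.card_vert_le_card_edgeSet_add_one
  have h2 : ¬ (gBall G v R).card ≤ Nat.card (G.induce (gBall G v R : Set (Fin n))).edgeSet :=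
    fun h => hb ⟨gBall G v R, mem_gBall_self G v R, gBall_card hG v R, hasEdges_of_card _ _ _ h⟩
  refine (SimpleGraph.isTree_iff_connected_and_card.2 ⟨hc, ?_⟩).isAcyclic
  have h3 : Nat.card (gBall G v R : Set (Fin n)) = (gBall G v R).card := by simp
  omega

lemma ball_full {n : ℕ} {G : SimpleGraph (Fin n)} (hG : G ∈ regGraphs n) (v : Fin n)
    (R : ℕ) (t : ℕ) : ∀ j x w, j + t ≤ R → x ∈ gBall G v j →
      DirFull (restrictTo G (gBall G v R)) t x w := by
  induction t with
  | zero => intros; trivial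
  | succ t ih =>
    intro j x w hj hx
    have hadj : ∀ y, G.Adj x y → (restrictTo G (gBall G v R)).Adj x y := fun y hy =>
      ⟨hy, gBall_mono G v (by omega) hx, gBall_mono G v (by omega) (gBall_adj G v hx hy)⟩
    refine ⟨?_, ?_⟩
    · have h4 := degree_of_reg hG x
      have h3 : 2 < ((Finset.univ.filter (fun y => G.Adj x y)).erase w).card := by
        have := Finset.pred_card_le_card_erase (a := w) (s := Finset.univ.filter (fun y => G.Adj x y))
        omega
      obtain ⟨a, b, c, ha, hb, hc, hab, hac, hbc⟩ := Finset.two_lt_card_iff.1 h3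
      simp only [Finset.mem_erase, Finset.mem_filter, Finset.mem_univ, true_and] at ha hb hc
      exact ⟨a, b, c, hab, hac, hbc, ⟨hadj _ ha.2, ha.1⟩, ⟨hadj _ hb.2, hb.1⟩, ⟨hadj _ hc.2, hc.1⟩⟩
    · intro y hy hyw
      exact ih (j + 1) y x (by omega) (gBall_adj G v hx hy.1)

lemma uninfected_prob (p : ℝ) (hp1 : 0.12 ≤ p) (hp2 : p ≤ 1) {n : ℕ} {G : SimpleGraph (Fin n)}
    (hG : G ∈ regGraphs n) (v : Fin n) (T : ℕ) (hb : ¬ BadVertex (5 ^ T) G v) :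
    (seedMeasure (Fin n) p).real {f | v ∉ (colorStep G)^[T] {v | f v = true}} ≤ 0.99 ^ T := by
  have h0 : 0 ≤ p := by norm_num at hp1; linarith
  have := seed_prob (V := Fin n) p h0 hp2
  refine le_trans (measureReal_mono ?_) (dirUn_prob p hp1 hp2 _ (restrict_ball_acyclic hG v T hb) T v v
    (ball_full hG v T T 0 v v (by omega) (mem_gBall_self G v 0)))
  intro f hf
  exact dirUn_of_not_mem G (restrictTo G (gBall G v T)) (fun x y h => h.1) _ T v v hf

lemma exists_core {n : ℕ} {G : SimpleGraph (Fin n)} (hG : G ∈ regGraphs n) (S : Set (Fin n))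
    (h : ¬ IsDynamo G S) (T : ℕ) : SmallCore G ∨
      n < 147456 * (Finset.univ.filter (fun v => v ∉ (colorStep G)^[T] S)).card := by
  by_contra hc
  push Not at hc
  obtain ⟨hc1, hc2⟩ := hc
  apply hc1
  let W : Finset (Fin n) := Finset.univ.filter (fun v => ∀ t, v ∉ (colorStep G)^[t] S)
  have hmono : Monotone (fun t => (colorStep G)^[t] S) := by
    apply monotone_nat_of_le_succ
    intro t
    rw [Function.iterate_succ_apply']
    exact Set.subset_union_left
  refine ⟨W, ?_, ?_, ?_⟩
  · simp only [IsDynamo, not_forall, not_exists] at h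
    obtain ⟨v, hv⟩ := h
    exact ⟨v, by simpa [W] using hv⟩
  · refine le_trans ?_ hc2
    gcongr
    intro v hv
    simp only [W, Finset.mem_filter, Finset.mem_univ, true_and] at hv ⊢
    exact hv T
  · intro v hv
    have h4 := degree_of_reg hG v
    rw [← Finset.card_filter_add_card_filter_not (s := Finset.univ.filter (fun x => G.Adj v x))
      (fun x => x ∈ W)] at h4
    have h5 : ((Finset.univ.filter (fun x => G.Adj v x)).filter (fun x => ¬ x ∈ W)).card ≤ 1 := by
      rw [Finset.card_le_one]
      intro a ha b hb
      by_contra hab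
      simp only [W, Finset.mem_filter, Finset.mem_univ, true_and, not_forall, not_not] at ha hb hv
      obtain ⟨ha, s, hs⟩ := ha
      obtain ⟨hb, t, ht⟩ := hb
      apply hv (max s t + 1)
      rw [Function.iterate_succ_apply']
      exact Or.inr ⟨a, b, hab, ha, hb, hmono (le_max_left s t) hs, hmono (le_max_right s t) ht⟩
    have h6 : (Finset.univ.filter (fun x => G.Adj v x)).filter (fun x => x ∈ W) =
      W.filter (fun x => G.Adj v x) := by
      ext; simp [and_comm]
    rw [h6] at h4
    omega

/-- nonemptiness: the circulant graph with jumps one and two -/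
lemma regGraphs_nonempty (n : ℕ) (hn : 5 ≤ n) : (regGraphs n).Nonempty := by
  obtain ⟨m, rfl⟩ : ∃ m, n = m + 5 := ⟨n - 5, by omega⟩
  refine ⟨SimpleGraph.circulantGraph ({1, 2} : Set (Fin (m + 5))), mem_regGraphs.2 fun v => ?_⟩
  have v1 : (1 : Fin (m + 5)).val = 1 := Fin.val_one (m + 3)
  have v2 : (2 : Fin (m + 5)).val = 2 := Fin.val_two (n := m + 2)
  have v3 : (-1 : Fin (m + 5)).val = m + 4 := by
    rw [Fin.val_neg', v1]; exact Nat.mod_eq_of_lt (by omega)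
  have v4 : (-2 : Fin (m + 5)).val = m + 3 := by
    rw [Fin.val_neg', v2]; exact Nat.mod_eq_of_lt (by omega)
  have h : (SimpleGraph.circulantGraph ({1, 2} : Set (Fin (m + 5)))).neighborSet v =
      (fun d => v + d) '' (({1, 2, -1, -2} : Finset (Fin (m + 5))) : Set (Fin (m + 5))) := by
    ext x
    have hne : ∀ d : Fin (m + 5), d.val ≠ 0 → v ≠ v + d := by
      intro d hd h
      apply hd
      rw [left_eq_add.1 h]
      rfl
    simp only [SimpleGraph.mem_neighborSet, SimpleGraph.circulantGraph_adj, Set.mem_insert_iff,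
      Set.mem_singleton_iff, Finset.coe_insert, Finset.coe_singleton, Set.mem_image]
    constructor
    · rintro ⟨-, (h | h) | (h | h)⟩
      · exact ⟨-1, by simp, by rw [← h]; abel⟩
      · exact ⟨-2, by simp, by rw [← h]; abel⟩
      · exact ⟨1, by simp, by rw [← h]; abel⟩
      · exact ⟨2, by simp, by rw [← h]; abel⟩
    · rintro ⟨d, (rfl | rfl | rfl | rfl), rfl⟩
      · exact ⟨hne _ (by omega), Or.inr (Or.inl (by abel))⟩
      · exact ⟨hne _ (by omega), Or.inr (Or.inr (by abel))⟩
      · exact ⟨hne _ (by omega), Or.inl (Or.inl (by abel))⟩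
      · exact ⟨hne _ (by omega), Or.inl (Or.inr (by abel))⟩
  rw [h, Set.ncard_image_of_injective _ (add_right_injective v), Set.ncard_coe_finset]
  rw [Finset.card_insert_of_notMem, Finset.card_insert_of_notMem, Finset.card_insert_of_notMem,
    Finset.card_singleton]
  all_goals
    simp only [Finset.mem_insert, Finset.mem_singleton, Fin.ext_iff, v1, v2, v3, v4]
    omega

end Ball

section Final
open scoped Classical

lemma markov_count (p : ℝ) (h0 : 0 ≤ p) (h1 : p ≤ 1) {n : ℕ} (hn : 0 < n)
    (Q : (Fin n → Bool) → Fin n → Prop) (D : ℕ) :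
    (seedMeasure (Fin n) p).real {f | n < D * (Finset.univ.filter (fun v => Q f v)).card} ≤
      D / n * ∑ v, (seedMeasure (Fin n) p).real {f | Q f v} := by
  have := seed_prob (V := Fin n) p h0 h1
  have hn0 : (0 : ℝ) < n := by exact_mod_cast hn
  let X : (Fin n → Bool) → ℝ := fun f => ∑ v, ({f | Q f v} : Set (Fin n → Bool)).indicator 1 f
  have hX : ∀ f, X f = (Finset.univ.filter (fun v => Q f v)).card := by
    intro f
    simp only [X, Set.indicator_apply, Finset.card_filter, Nat.cast_sum]
    refine Finset.sum_congr rfl fun v _ => ?_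
    change (if Q f v then _ else _) = _
    split_ifs <;> simp
  have hXint : ∫ f, X f ∂(seedMeasure (Fin n) p) = ∑ v, (seedMeasure (Fin n) p).real {f | Q f v} := by
    rw [integral_finsetSum _ (fun v _ => Integrable.of_finite)]
    refine Finset.sum_congr rfl fun v _ => ?_
    rw [integral_indicator_one (all_meas _)]
  have hm := mul_meas_ge_le_integral_of_nonneg (μ := seedMeasure (Fin n) p) (f := fun f => D * X f)
    (Eventually.of_forall fun f => by
      change 0 ≤ D * X f
      rw [hX]; positivity) Integrable.of_finite n
  rw [integral_const_mul, hXint] at hm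
  rw [div_mul_eq_mul_div, le_div_iff₀ hn0, mul_comm]
  refine le_trans (mul_le_mul_of_nonneg_left (measureReal_mono ?_) hn0.le) hm
  intro f hf
  change (n : ℝ) ≤ D * X f
  rw [hX]
  have hf : n < D * (Finset.univ.filter (fun v => Q f v)).card := hf
  exact_mod_cast hf.le

lemma main_bound (p : ℝ) (hp1 : 0.12 ≤ p) (hp2 : p ≤ 1) (T : ℕ) : ∃ C : ℝ, ∀ n : ℕ, 48 ≤ n →
    2 * 5 ^ T ≤ n →
    ∑ G ∈ regGraphs n, (seedMeasure (Fin n) p).real {f | ¬ IsDynamo G {v | f v = true}} ≤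
      (768 / Real.sqrt n + 147456 * (C / n + 0.99 ^ T)) * (regGraphs n).card := by
  obtain ⟨C, hC⟩ := badVertex_count (5 ^ T)
  refine ⟨C, fun n hn hT => ?_⟩
  have h0 : 0 ≤ p := by norm_num at hp1; linarith
  have := seed_prob (V := Fin n) p h0 hp2
  have hn0 : (0 : ℝ) < n := by exact_mod_cast (by omega : 0 < n)
  set N : ℝ := ((regGraphs n).card : ℝ) with hN
  have hG : ∀ G ∈ regGraphs n,
      (seedMeasure (Fin n) p).real {f | ¬ IsDynamo G {v | f v = true}} ≤
      (if SmallCore G then 1 else 0) + 147456 / n * ∑ v : Fin n,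
        ((if BadVertex (5 ^ T) G v then 1 else 0) + 0.99 ^ T) := by
    intro G hG
    have hsum : ∑ v : Fin n, (seedMeasure (Fin n) p).real
        {f | v ∉ (colorStep G)^[T] {v | f v = true}} ≤
        ∑ v : Fin n, ((if BadVertex (5 ^ T) G v then (1 : ℝ) else 0) + 0.99 ^ T) := by
      refine Finset.sum_le_sum fun v _ => ?_
      split_ifs with hb
      · exact measureReal_le_one.trans (by simp; positivity)
      · simpa using uninfected_prob p hp1 hp2 hG v T hb
    have hs0 : 0 ≤ ∑ v : Fin n, ((if BadVertex (5 ^ T) G v then (1 : ℝ) else 0) + 0.99 ^ T) :=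
      (Finset.sum_nonneg fun v _ => measureReal_nonneg).trans hsum
    by_cases hs : SmallCore G
    · rw [if_pos hs]
      refine measureReal_le_one.trans ?_
      have : 0 ≤ 147456 / (n : ℝ) *
        ∑ v : Fin n, ((if BadVertex (5 ^ T) G v then (1 : ℝ) else 0) + 0.99 ^ T) := by positivity
      linarith
    · rw [if_neg hs, zero_add]
      have hm := markov_count p h0 hp2 (by omega : 0 < n)
        (fun f v => v ∉ (colorStep G)^[T] {v | f v = true}) 147456
      refine le_trans (measureReal_mono ?_) (hm.trans ?_)
      · intro f hf
        have hres := (exists_core hG _ hf T).resolve_left hs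
        rw [Set.mem_ofPred_eq]
        refine lt_of_lt_of_eq hres ?_
        congr!
      · push_cast
        gcongr
  refine (Finset.sum_le_sum hG).trans ?_
  rw [Finset.sum_add_distrib, ← Finset.mul_sum, Finset.sum_comm]
  have e1 : ∑ G ∈ regGraphs n, (if SmallCore G then (1 : ℝ) else 0) ≤ 768 / Real.sqrt n * N := by
    rw [Finset.sum_boole]
    exact smallCore_count hn
  have e2 : ∑ v : Fin n, ∑ G ∈ regGraphs n,
      ((if BadVertex (5 ^ T) G v then (1 : ℝ) else 0) + 0.99 ^ T) ≤ C * N + n * (N * 0.99 ^ T) := by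
    simp_rw [Finset.sum_add_distrib, Finset.sum_boole]
    simp only [Finset.sum_const, Finset.card_univ, Fintype.card_fin, nsmul_eq_mul]
    have := hC n hn hT
    rw [← hN] at this ⊢
    linarith
  calc _ ≤ 768 / Real.sqrt n * N + 147456 / n * (C * N + n * (N * 0.99 ^ T)) := by gcongr
    _ = _ := by field_simp

lemma ratio_tendsto (p : ℝ) (hp1 : 0.12 ≤ p) (hp2 : p ≤ 1) :
    Tendsto (fun n : ℕ => (∑ G ∈ regGraphs n,
      (seedMeasure (Fin n) p).real {f | ¬ IsDynamo G {v | f v = true}}) / (regGraphs n).card)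
      atTop (nhds 0) := by
  rw [tendsto_order]
  constructor
  · intro a ha
    refine Eventually.of_forall fun n => lt_of_lt_of_le ha ?_
    exact div_nonneg (Finset.sum_nonneg fun _ _ => measureReal_nonneg) (Nat.cast_nonneg _)
  · intro ε hε
    obtain ⟨T, hT⟩ := exists_pow_lt_of_lt_one (show (0 : ℝ) < ε / 147456 by positivity)
      (show (0.99 : ℝ) < 1 by norm_num)
    obtain ⟨C, hC⟩ := main_bound p hp1 hp2 T
    have hlim : Tendsto (fun n : ℕ => 768 / Real.sqrt n + 147456 * (C / n + 0.99 ^ T)) atTop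
        (nhds (0 + 147456 * (0 + 0.99 ^ T))) := by
      refine Tendsto.add ?_ (Tendsto.const_mul _ (Tendsto.add ?_ tendsto_const_nhds))
      · exact Tendsto.const_div_atTop (Real.tendsto_sqrt_atTop.comp tendsto_natCast_atTop_atTop) _
      · exact tendsto_const_div_atTop_nhds_zero_nat C
    have hlt : (0 : ℝ) + 147456 * (0 + 0.99 ^ T) < ε := by
      rw [lt_div_iff₀ (by norm_num)] at hT
      linarith
    filter_upwards [hlim.eventually_lt_const hlt, eventually_ge_atTop 48,
      eventually_ge_atTop (2 * 5 ^ T)] with n h1 h2 h3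
    have hpos : (0 : ℝ) < (regGraphs n).card := by
      exact_mod_cast (regGraphs_nonempty n (by omega)).card_pos
    rw [div_lt_iff₀ hpos]
    exact (hC n h2 h3).trans_lt (by gcongr)

end Final

/-- Fix `0.12 ≤ p ≤ 1`.  If a 4-regular simple graph `G` on `Fin n` is chosen uniformly at
random and, independently, each vertex is put into the seed set with probability `p`, then
the probability that the seed set is a dynamo on `G` tends to `1` as `n → ∞`.  (The
probability is written as the average, over all 4-regular graphs on `Fin n`, of the
Bernoulli(p)-probability that the seed set is a dynamo.) -/
theorem regular_dynamo_whp (p : ℝ) (hp1 : 0.12 ≤ p) (hp2 : p ≤ 1) :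
    Filter.Tendsto
      (fun n : ℕ =>
        (∑ G ∈ regGraphs n,
            seedMeasure (Fin n) p {f | IsDynamo G {v | f v = true}})
          / ((regGraphs n).card : ENNReal))
      Filter.atTop (nhds 1) := by
  have h0 : 0 ≤ p := by norm_num at hp1; linarith
  have h1 := (ratio_tendsto p hp1 hp2).const_sub 1
  have h2 := ENNReal.tendsto_ofReal h1
  rw [sub_zero, ENNReal.ofReal_one] at h2
  refine h2.congr' ?_
  filter_upwards [eventually_ge_atTop 5] with n hn
  have := seed_prob (V := Fin n) p h0 hp2
  have hpos : (0 : ℝ) < (regGraphs n).card := by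
    exact_mod_cast (regGraphs_nonempty n hn).card_pos
  have e1 : ∀ G : SimpleGraph (Fin n), seedMeasure (Fin n) p {f | IsDynamo G {v | f v = true}} =
      ENNReal.ofReal (1 - (seedMeasure (Fin n) p).real {f | ¬ IsDynamo G {v | f v = true}}) := by
    intro G
    have e2 := probReal_compl_eq_one_sub (μ := seedMeasure (Fin n) p)
      (s := {f | ¬ IsDynamo G {v | f v = true}}) (all_meas _)
    rw [← e2, ofReal_measureReal]
    congr 1
    ext f
    simp
  simp_rw [e1]
  rw [← ENNReal.ofReal_sum_of_nonneg (fun G _ => sub_nonneg.2 measureReal_le_one),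
    ← ENNReal.ofReal_natCast, ← ENNReal.ofReal_div_of_pos hpos]
  congr 1
  rw [Finset.sum_sub_distrib, sub_div]
  simp [hpos.ne']
end

section
/- Fix p with 0 ≤ p ≤ 0.10. For n ≥ 5, let G be sampled uniformly at random from the (nonempty, finite) set of 4-regular simple graphs on the vertex set Fin n, and let the random seed set S^p include each vertex independently with probability p (independently of G). Then the probability that S^p is a dynamo on G under the majority coloring process of threshold 2 tends to 0 as n → ∞. -/
open MeasureTheory Filter

open scoped Classical in
/-- free points of `P` at vertex `v`. -/
noncomputable def cnt {V : Type*} (P : Finset (V × Fin 4)) (v : V) : ℕ :=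
  (P.filter (fun x => x.1 = v)).card

def NoStuck {V : Type*} (S : Set V) (P : Finset (V × Fin 4)) (M : V × Fin 4 → V × Fin 4) : Prop :=
  ∀ Q ⊆ P, Q.Nonempty → (∀ x ∈ Q, M x ∈ Q) → ∃ a ∈ Q, a.1 ∈ S ∨ cnt Q a.1 ≤ 2

open scoped Classical in
noncomputable def Mat {V : Type*} [Fintype V] (S : Set V) (P : Finset (V × Fin 4)) :
    Finset (V × Fin 4 → V × Fin 4) :=
  Finset.univ.filter (fun M => (∀ x, M (M x) = x) ∧ (∀ x, M x ≠ x ↔ x ∈ P) ∧ NoStuck S P M)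

section part2
set_option linter.unusedSectionVars false
open scoped Classical
open scoped Nat

variable {V : Type*} [Fintype V]

lemma mat_rec (S : Set V) (P : Finset (V × Fin 4)) (a : V × Fin 4) (ha : a ∈ P) :
    (Mat S P).card ≤ ∑ b ∈ P.erase a, (Mat S ((P.erase a).erase b)).card := by
  rw [Finset.card_eq_sum_card_fiberwise (f := fun M => M a) (t := P.erase a)]
  · apply Finset.sum_le_sum
    intro b hb
    apply Finset.card_le_card_of_injOn (fun M x => if x = a ∨ x = b then x else M x)
    · intro M hM
      simp only [Mat, Finset.coe_filter, Finset.mem_filter, Finset.mem_univ, true_and,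
        Set.mem_ofPred_eq] at hM ⊢
      obtain ⟨⟨h1, h2, h3⟩, h4⟩ := hM
      have hMb : M b = a := by rw [← h4, h1]
      refine ⟨?_, ?_, ?_⟩
      · intro x
        by_cases hx : x = a ∨ x = b
        · simp [hx]
        · have : ¬ (M x = a ∨ M x = b) := by
            rintro (h | h)
            · apply hx; right; rw [← h1 x, h, h4]
            · apply hx; left; rw [← h1 x, h, hMb]
          simp [hx, this, h1]
      · intro x
        by_cases hx : x = a ∨ x = b
        · simp only [hx, if_true, ne_eq, not_true, Finset.mem_erase, false_iff]
          rcases hx with h | h <;> simp [h]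
        · simp only [hx, if_false, Finset.mem_erase]
          rw [h2]
          push Not at hx
          simp [hx]
      · intro Q hQ hne hinv
        apply h3 Q _ hne
        · intro x hx
          have hxP := hQ hx
          simp only [Finset.mem_erase] at hxP
          have := hinv x hx
          simpa [hxP.1, hxP.2.1] using this
        · exact hQ.trans ((Finset.erase_subset _ _).trans (Finset.erase_subset _ _))
    · intro M hM M' hM' heq
      simp only [Mat, Finset.coe_filter, Finset.mem_filter, Finset.mem_univ, true_and,
        Set.mem_ofPred_eq] at hM hM'
      have hMb : M b = a := by rw [← hM.2, hM.1.1]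
      have hMb' : M' b = a := by rw [← hM'.2, hM'.1.1]
      funext x
      by_cases hxa : x = a
      · rw [hxa, hM.2, hM'.2]
      by_cases hxb : x = b
      · rw [hxb, hMb, hMb']
      have := congrFun heq x
      simpa [hxa, hxb] using this
  · intro M hM
    simp only [Mat, Finset.coe_filter, Finset.mem_univ, true_and, Set.mem_ofPred_eq] at hM
    obtain ⟨h1, h2, h3⟩ := hM
    simp only [Finset.coe_erase, Set.mem_sdiff, Finset.mem_coe, Set.mem_singleton_iff]
    refine ⟨?_, (h2 a).2 ha⟩
    rw [← h2, h1]
    exact ((h2 a).2 ha).symm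

lemma card_erase2 {P : Finset (V × Fin 4)} {a b : V × Fin 4} (ha : a ∈ P) (hb : b ∈ P.erase a) :
    ((P.erase a).erase b).card = P.card - 2 := by
  rw [Finset.card_erase_of_mem hb, Finset.card_erase_of_mem ha]; omega

lemma mat_card_le (S : Set V) (m : ℕ) : ∀ P : Finset (V × Fin 4), P.card = m →
    (Mat S P).card ≤ (m - 1)‼ := by
  induction m using Nat.strong_induction_on with
  | _ m ih =>
    intro P hP
    rcases P.eq_empty_or_nonempty with h | ⟨a, ha⟩
    · subst h
      simp at hP
      subst hP
      simp only [Nat.zero_sub, Nat.doubleFactorial]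
      rw [Finset.card_le_one]
      intro M hM M' hM'
      simp only [Mat, Finset.mem_filter, Finset.mem_univ, true_and] at hM hM'
      funext x
      have h1 := (hM.2.1 x)
      have h2 := (hM'.2.1 x)
      simp at h1 h2
      rw [h1, h2]
    · refine (mat_rec S P a ha).trans ?_
      have : ∀ b ∈ P.erase a, (Mat S ((P.erase a).erase b)).card ≤ (m - 2 - 1)‼ := by
        intro b hb
        have hc := card_erase2 ha hb
        have : 0 < m := by rw [← hP]; exact Finset.card_pos.2 ⟨a, ha⟩
        exact ih (m-2) (by omega) _ (by rw [hc, hP])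
      refine (Finset.sum_le_card_nsmul _ _ _ this).trans ?_
      rw [Finset.card_erase_of_mem ha, hP, smul_eq_mul]
      rcases m with _ | _ | m
      · simp
      · simp
      · show (m + 1) * (m - 1)‼ ≤ (m+1)‼
        rcases m with _ | m
        · simp
        · simp [Nat.doubleFactorial]

noncomputable def wt (S : Set V) (fw : ℕ → ℝ) (P : Finset (V × Fin 4)) : ℝ :=
  ∏ v ∈ Finset.univ.filter (fun v => v ∉ S), fw (cnt P v)

lemma cnt_erase {P : Finset (V × Fin 4)} {a : V × Fin 4} (ha : a ∈ P) (v : V) :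
    cnt (P.erase a) v = if a.1 = v then cnt P v - 1 else cnt P v := by
  unfold cnt
  rw [Finset.filter_erase]
  split_ifs with h
  · rw [Finset.card_erase_of_mem (by simp [ha, h])]
  · rw [Finset.erase_eq_of_notMem (by simp [h])]

lemma wt_erase_active (S : Set V) (fw : ℕ → ℝ) (h2 : ∀ c ≤ 2, fw c = 1)
    {P : Finset (V × Fin 4)} {a : V × Fin 4} (ha : a ∈ P) (hact : a.1 ∈ S ∨ cnt P a.1 ≤ 2) :
    wt S fw (P.erase a) = wt S fw P := by
  unfold wt
  apply Finset.prod_congr rfl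
  intro v hv
  simp at hv
  rw [cnt_erase ha]
  split_ifs with h
  · subst h
    have := hact.resolve_left hv
    rw [h2 _ this, h2 _ (by omega)]
  · rfl

lemma wt_erase (S : Set V) (fw : ℕ → ℝ) (hpos : ∀ c, 0 < fw c) 
    {P : Finset (V × Fin 4)} {b : V × Fin 4} (hb : b ∈ P) :
    wt S fw (P.erase b) =
      wt S fw P * (1 + if b.1 ∉ S then (fw (cnt P b.1 - 1) / fw (cnt P b.1) - 1) else 0) := by
  by_cases h : b.1 ∈ S
  · simp only [h, not_true, if_false, add_zero, mul_one]
    unfold wt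
    apply Finset.prod_congr rfl
    intro v hv
    simp at hv
    rw [cnt_erase hb, if_neg]
    rintro rfl
    exact hv h
  · simp only [h, not_false_iff, if_true]
    unfold wt
    have hm : b.1 ∈ Finset.univ.filter (fun v => v ∉ S) := by simp [h]
    rw [← Finset.mul_prod_erase _ _ hm, ← Finset.mul_prod_erase (Finset.univ.filter (fun v => v ∉ S))
      (fun v => fw (cnt P v)) hm, cnt_erase hb, if_pos rfl]
    have : ∏ x ∈ (Finset.univ.filter (fun v => v ∉ S)).erase b.1, fw (cnt (P.erase b) x) =
      ∏ x ∈ (Finset.univ.filter (fun v => v ∉ S)).erase b.1, fw (cnt P x) := by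
      apply Finset.prod_congr rfl
      intro v hv
      simp at hv
      rw [cnt_erase hb, if_neg (fun h => hv.1 h.symm)]
    rw [this]
    have := (hpos (cnt P b.1)).ne'
    field_simp
    ring

lemma one_add_sum_le_prod' {ι : Type*} (s : Finset ι) (f : ι → ℝ) (hf : ∀ i ∈ s, 1 ≤ f i) :
    1 + ∑ i ∈ s, (f i - 1) ≤ ∏ i ∈ s, f i ∧ 1 ≤ ∏ i ∈ s, f i := by
  induction s using Finset.induction_on with
  | empty => simp
  | insert i s hi ih =>
    obtain ⟨h1, h2⟩ := ih (fun j hj => hf j (Finset.mem_insert_of_mem hj))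
    have h3 := hf i (Finset.mem_insert_self _ _)
    rw [Finset.sum_insert hi, Finset.prod_insert hi]
    constructor <;> nlinarith

lemma wt_step (S : Set V) (fw gw : ℕ → ℝ) (hpos : ∀ c, 0 < fw c) (h2 : ∀ c ≤ 2, fw c = 1)
    (hanti : ∀ c, fw c ≤ fw (c - 1))
    {P : Finset (V × Fin 4)} {a : V × Fin 4} (ha : a ∈ P) (hact : a.1 ∈ S ∨ cnt P a.1 ≤ 2)
    (hm : 2 ≤ P.card)
    (hgw : ∀ c, fw c + c * (fw (c-1) - fw c) / (P.card - 1 : ℝ) ≤ gw c) :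
    ∑ b ∈ P.erase a, wt S fw ((P.erase a).erase b) ≤ (P.card - 1 : ℝ) * wt S gw P := by
  have hw : 0 < wt S fw P := Finset.prod_pos (fun v _ => hpos _)
  have hm' : (0:ℝ) < P.card - 1 := by
    have : (2:ℝ) ≤ P.card := by exact_mod_cast hm
    linarith
  set g : ℕ → ℝ := fun c => fw (c-1) / fw c - 1 with hg
  have hgn : ∀ c, 0 ≤ g c := by
    intro c
    have := (one_le_div (hpos c)).2 (hanti c)
    simp only [hg]; linarith
  -- per-point identity
  have e1 : ∀ b ∈ P.erase a, wt S fw ((P.erase a).erase b) =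
      wt S fw P * (1 + if b.1 ∉ S then g (cnt P b.1) else 0) := by
    intro b hb
    have hbP := Finset.mem_of_mem_erase hb
    have hba := Finset.ne_of_mem_erase hb
    rw [Finset.erase_right_comm]
    rw [wt_erase_active S fw h2 (P := P.erase b) (Finset.mem_erase.2 ⟨hba.symm, ha⟩)]
    · exact wt_erase S fw hpos hbP
    · rcases hact with h | h
      · exact Or.inl h
      · right
        rw [cnt_erase hbP]
        split_ifs <;> omega
  rw [Finset.sum_congr rfl e1, ← Finset.mul_sum, Finset.sum_add_distrib]
  have e2 : ∑ b ∈ P.erase a, (1:ℝ) = P.card - 1 := by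
    rw [Finset.sum_const, Finset.card_erase_of_mem ha, nsmul_eq_mul, mul_one]
    rw [Nat.cast_sub (by omega)]; simp
  have e3 : ∑ b ∈ P.erase a, (if b.1 ∉ S then g (cnt P b.1) else 0) ≤
      ∑ b ∈ P, (if b.1 ∉ S then g (cnt P b.1) else 0) := by
    apply Finset.sum_le_sum_of_subset_of_nonneg (Finset.erase_subset _ _)
    intro i _ _
    split_ifs
    · exact le_rfl
    · exact hgn _
  have e4 : ∑ b ∈ P, (if b.1 ∉ S then g (cnt P b.1) else 0) =
      ∑ v ∈ Finset.univ.filter (fun v => v ∉ S), (cnt P v : ℝ) * g (cnt P v) := by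
    rw [← Finset.sum_fiberwise (s := P) (g := fun b => b.1), Finset.sum_filter]
    apply Finset.sum_congr rfl
    intro v _
    rw [Finset.sum_congr rfl (g := fun _ => if v ∉ S then g (cnt P v) else 0)]
    · rw [Finset.sum_const, nsmul_eq_mul]
      split_ifs
      · simp
      · rfl
    · intro b hb
      simp only [Finset.mem_filter] at hb
      rw [hb.2]
  have e5 : ∀ c, 1 + c * g c / (P.card - 1 : ℝ) ≤ gw c / fw c := by
    intro c
    rw [le_div_iff₀ (hpos c)]
    refine le_trans (le_of_eq ?_) (hgw c)
    simp only [hg]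
    have := (hpos c).ne'
    field_simp
  have e6 := (one_add_sum_le_prod' (Finset.univ.filter (fun v => v ∉ S))
    (fun v => gw (cnt P v) / fw (cnt P v)) (by
      intro v _
      refine le_trans ?_ (e5 _)
      have := hgn (cnt P v)
      have : 0 ≤ (cnt P v : ℝ) * g (cnt P v) / (P.card - 1 : ℝ) := by positivity
      linarith)).1
  have e7 : ∏ v ∈ Finset.univ.filter (fun v => v ∉ S), gw (cnt P v) / fw (cnt P v) =
      wt S gw P / wt S fw P := by
    rw [Finset.prod_div_distrib]; rfl
  rw [e7, le_div_iff₀ hw] at e6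
  have e8 : ∑ v ∈ Finset.univ.filter (fun v => v ∉ S), (cnt P v : ℝ) * g (cnt P v) / (P.card - 1 : ℝ)
     ≤ ∑ v ∈ Finset.univ.filter (fun v => v ∉ S), (gw (cnt P v) / fw (cnt P v) - 1) := by
    apply Finset.sum_le_sum
    intro v _
    linarith [e5 (cnt P v)]
  rw [← Finset.sum_div, div_le_iff₀ hm'] at e8
  rw [e2]
  calc wt S fw P * ((P.card - 1 : ℝ) + ∑ b ∈ P.erase a, (if b.1 ∉ S then g (cnt P b.1) else 0))
      ≤ wt S fw P * ((P.card - 1 : ℝ) + 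
        (∑ v ∈ Finset.univ.filter (fun v => v ∉ S), (gw (cnt P v) / fw (cnt P v) - 1)) * (P.card - 1 : ℝ)) := by
        apply mul_le_mul_of_nonneg_left _ hw.le
        linarith
    _ = (P.card - 1 : ℝ) * ((1 + ∑ v ∈ Finset.univ.filter (fun v => v ∉ S), (gw (cnt P v) / fw (cnt P v) - 1)) * wt S fw P) := by ring
    _ ≤ _ := mul_le_mul_of_nonneg_left e6 hm'.le

lemma mat_bound (S : Set V) (fw : ℕ → ℕ → ℝ) (m0 : ℕ) (C : ℝ) (hC : 0 ≤ C)
    (hpos : ∀ k c, 0 < fw k c) (h2 : ∀ k, ∀ c ≤ 2, fw k c = 1)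
    (hanti : ∀ k c, fw k c ≤ fw k (c - 1))
    (hstep : ∀ k c, fw k c + c * (fw k (c-1) - fw k c) / ((m0 + 2 * (k+1) : ℕ) - 1 : ℝ) ≤ fw (k+1) c)
    (hbase : ∀ P : Finset (V × Fin 4), P.card = m0 → 1 ≤ C * wt S (fw 0) P) (k : ℕ) :
    ∀ P : Finset (V × Fin 4), P.card = m0 + 2 * k →
      ((Mat S P).card : ℝ) ≤ ((m0 + 2 * k - 1)‼ : ℕ) * (C * wt S (fw k) P) := by
  induction k with
  | zero =>
    intro P hP
    have h1 : ((Mat S P).card : ℝ) ≤ ((m0 + 2 * 0 - 1)‼ : ℕ) := by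
      exact_mod_cast mat_card_le S _ P hP
    have := hbase P hP
    nlinarith [Nat.cast_nonneg (α := ℝ) ((m0 + 2 * 0 - 1)‼)]
  | succ k ih =>
    intro P hP
    rcases (Mat S P).eq_empty_or_nonempty with h | ⟨M, hM⟩
    · rw [h]
      have : 0 < wt S (fw (k+1)) P := Finset.prod_pos (fun v _ => hpos _ _)
      simp only [Finset.card_empty, Nat.cast_zero]
      positivity
    simp only [Mat, Finset.mem_filter, Finset.mem_univ, true_and] at hM
    obtain ⟨h1, h2', h3⟩ := hM
    have hne : P.Nonempty := by rw [← Finset.card_pos]; omega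
    obtain ⟨a, ha, hact⟩ := h3 P subset_rfl hne (by
      intro x hx
      rw [← h2', h1]
      exact ((h2' x).2 hx).symm)
    have hs := wt_step S (fw k) (fw (k+1)) (hpos k) (h2 k) (hanti k) ha hact (by omega)
      (by rw [hP]; exact hstep k)
    calc ((Mat S P).card : ℝ) ≤ ∑ b ∈ P.erase a, ((Mat S ((P.erase a).erase b)).card : ℝ) := by
          exact_mod_cast mat_rec S P a ha
      _ ≤ ∑ b ∈ P.erase a, ((m0 + 2 * k - 1)‼ : ℕ) * (C * wt S (fw k) ((P.erase a).erase b)) := by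
          apply Finset.sum_le_sum
          intro b hb
          exact ih _ (by rw [card_erase2 ha hb]; omega)
      _ = ((m0 + 2 * k - 1)‼ : ℕ) * C * ∑ b ∈ P.erase a, wt S (fw k) ((P.erase a).erase b) := by
          rw [Finset.mul_sum]; apply Finset.sum_congr rfl; intros; ring
      _ ≤ ((m0 + 2 * k - 1)‼ : ℕ) * C * ((P.card - 1 : ℝ) * wt S (fw (k+1)) P) := by
          apply mul_le_mul_of_nonneg_left hs; positivity
      _ = _ := by
          have : (m0 + 2 * (k+1) - 1)‼ = (P.card - 1) * (m0 + 2 * k - 1)‼ := by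
            rw [hP]
            rcases h : m0 + 2 * k with _ | q
            · have : m0 + 2 * (k+1) = 2 := by omega
              rw [this]; simp
            · have : m0 + 2 * (k+1) = q + 3 := by omega
              rw [this]
              simp [Nat.doubleFactorial]
          rw [this]
          push_cast [Nat.cast_sub (show 1 ≤ P.card by omega)]
          ring

end part2

section part3
open scoped Classical

variable {V : Type*} [Fintype V]

/-- 4-regular graphs on a general finite type -/
noncomputable def regG (V : Type*) [Fintype V] : Finset (SimpleGraph V) :=
  Finset.univ.filter (fun G => ∀ v, (G.neighborSet v).ncard = 4)

lemma exists_labels (G : SimpleGraph V) (hG : ∀ v, (G.neighborSet v).ncard = 4) :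
    ∃ (nb : V → Fin 4 → V) (idx : V → V → Fin 4), (∀ v i, G.Adj v (nb v i)) ∧
      (∀ v u, G.Adj v u → nb v (idx v u) = u) ∧ (∀ v i, idx v (nb v i) = i) := by
  have key : ∀ v, Nonempty (G.neighborSet v ≃ Fin 4) := by
    intro v
    have : Nat.card (G.neighborSet v) = 4 := hG v
    exact ⟨Finite.equivFinOfCardEq this⟩
  let e := fun v => (key v).some
  refine ⟨fun v i => ((e v).symm i).1, fun v u => if h : G.Adj v u then e v ⟨u, h⟩ else 0, ?_, ?_, ?_⟩
  · intro v i
    exact ((e v).symm i).2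
  · intro v u h
    simp [h]
  · intro v i
    have : G.Adj v ((e v).symm i).1 := ((e v).symm i).2
    simp only [this, dif_pos]
    exact (e v).apply_symm_apply i

noncomputable def mkM (nb : V → Fin 4 → V) (idx : V → V → Fin 4) (π : V → Equiv.Perm (Fin 4)) :
    V × Fin 4 → V × Fin 4 :=
  fun x => (nb x.1 ((π x.1).symm x.2), π (nb x.1 ((π x.1).symm x.2))
    (idx (nb x.1 ((π x.1).symm x.2)) x.1))

lemma noStuck_of_dynamo (G : SimpleGraph V) (S : Set V) (M : V × Fin 4 → V × Fin 4)
    (hM : ∀ v u, G.Adj v u → ∃ i, (M (v, i)).1 = u) (hd : IsDynamo G S) :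
    NoStuck S Finset.univ M := by
  intro Q _ hne hinv
  by_contra hcon
  push Not at hcon
  have key : ∀ t, ∀ x ∈ Q, x.1 ∉ (colorStep G)^[t] S := by
    intro t
    induction t with
    | zero => intro x hx; exact (hcon x hx).1
    | succ t ih =>
      intro x hx hmem
      rw [Function.iterate_succ_apply'] at hmem
      rcases hmem with h | ⟨u, w, huw, hu, hw, huS, hwS⟩
      · exact ih x hx h
      · obtain ⟨i, hi⟩ := hM _ _ hu
        obtain ⟨j, hj⟩ := hM _ _ hw
        have hiQ : (x.1, i) ∉ Q := fun h => ih _ (hinv _ h) (hi ▸ huS)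
        have hjQ : (x.1, j) ∉ Q := fun h => ih _ (hinv _ h) (hj ▸ hwS)
        have hij : i ≠ j := by rintro rfl; exact huw (hi.symm.trans hj)
        have h3 := (hcon x hx).2
        have : cnt Q x.1 ≤ (((Finset.univ : Finset (Fin 4)).erase i).erase j).card := by
          unfold cnt
          apply Finset.card_le_card_of_injOn (fun y => y.2)
          · intro y hy
            simp only [Finset.coe_filter, Set.mem_ofPred_eq] at hy
            simp only [Finset.coe_erase, Finset.coe_univ, Set.mem_sdiff, Set.mem_univ, true_and,
              Set.mem_singleton_iff]
            constructor
            · rintro rfl; apply hiQ; rw [← hy.2]; exact hy.1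
            · rintro rfl; apply hjQ; rw [← hy.2]; exact hy.1
          · intro y hy z hz h
            simp only [Finset.coe_filter, Set.mem_ofPred_eq] at hy hz
            exact Prod.ext (hy.2.trans hz.2.symm) h
        rw [Finset.card_erase_of_mem (by simp [hij.symm]), Finset.card_erase_of_mem (by simp)] at this
        simp at this
        omega
  obtain ⟨x, hx⟩ := hne
  obtain ⟨t, ht⟩ := hd x.1
  exact key t x hx ht

lemma bad_card_le (S : Set V) :
    ((regG V).filter (fun G => IsDynamo G S)).card * 24 ^ (Fintype.card V) ≤
      (Mat S (Finset.univ : Finset (V × Fin 4))).card := by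
  have hcard : 24 ^ (Fintype.card V) = (Finset.univ : Finset (V → Equiv.Perm (Fin 4))).card := by
    rw [Finset.card_univ, Fintype.card_fun, Fintype.card_perm]
    simp [Nat.factorial]
  rw [hcard, ← Finset.card_product]
  have hex : ∀ G : SimpleGraph V, ∃ q : (V → Fin 4 → V) × (V → V → Fin 4),
      (∀ v, (G.neighborSet v).ncard = 4) → ((∀ v i, G.Adj v (q.1 v i)) ∧
      (∀ v u, G.Adj v u → q.1 v (q.2 v u) = u) ∧ (∀ v i, q.2 v (q.1 v i) = i)) := by
    intro G
    by_cases hG : ∀ v, (G.neighborSet v).ncard = 4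
    · obtain ⟨nb, idx, h⟩ := exists_labels G hG
      exact ⟨(nb, idx), fun _ => h⟩
    · refine ⟨(fun v _ => v, fun _ _ => 0), fun h => absurd h hG⟩
  choose q hq using hex
  apply Finset.card_le_card_of_injOn (fun z => mkM (q z.1).1 (q z.1).2 z.2)
  · rintro ⟨G, π⟩ hz
    simp only [regG, Finset.coe_product, Finset.filter_filter, Finset.coe_filter,
      Finset.mem_univ, true_and, Set.mem_prod, Set.mem_ofPred_eq] at hz
    obtain ⟨⟨hG, hd⟩, -⟩ := hz
    obtain ⟨h1, h2, h3⟩ := hq G hG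
    simp only [Mat, Finset.coe_filter, Finset.mem_univ, true_and, Set.mem_ofPred_eq, iff_true]
    refine ⟨?_, ?_, ?_⟩
    · rintro ⟨v, i⟩
      have ha := h1 v ((π v).symm i)
      simp only [mkM]
      simp [h2 _ _ ha.symm, h3]
    · rintro ⟨v, i⟩ h
      have ha := h1 v ((π v).symm i)
      have := congrArg Prod.fst h
      simp only [mkM] at this
      rw [this] at ha
      exact G.loopless.irrefl _ ha
    · apply noStuck_of_dynamo G S _ _ hd
      intro v u h
      refine ⟨π v ((q G).2 v u), ?_⟩
      simp [mkM, h2 _ _ h]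
  · rintro ⟨G, π⟩ hz ⟨G', π'⟩ hz' heq
    simp only [regG, Finset.coe_product, Finset.filter_filter, Finset.coe_filter,
      Finset.mem_univ, true_and, Set.mem_prod, Set.mem_ofPred_eq] at hz hz'
    obtain ⟨⟨hG, hd⟩, -⟩ := hz
    obtain ⟨⟨hG', hd'⟩, -⟩ := hz'
    obtain ⟨h1, h2, h3⟩ := hq G hG
    obtain ⟨h1', h2', h3'⟩ := hq G' hG'
    have hA : ∀ (H : SimpleGraph V) (ρ : V → Equiv.Perm (Fin 4)), (∀ v i, H.Adj v ((q H).1 v i)) →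
        (∀ v u, H.Adj v u → (q H).1 v ((q H).2 v u) = u) → 
        ∀ v u, H.Adj v u ↔ ∃ i, (mkM (q H).1 (q H).2 ρ (v, i)).1 = u := by
      intro H ρ g1 g2 v u
      constructor
      · intro h
        exact ⟨ρ v ((q H).2 v u), by simp [mkM, g2 _ _ h]⟩
      · rintro ⟨i, rfl⟩
        exact g1 _ _
    have hGG : G = G' := by
      ext v u
      rw [hA G π h1 h2, hA G' π' h1' h2']
      simp only at heq
      rw [heq]
    subst hGG
    congr 1
    funext v
    rw [← Equiv.symm_bijective.injective.eq_iff]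
    ext i : 1
    have := congrArg Prod.fst (congrFun heq (v, i))
    simp only [mkM] at this
    rw [← h3 v ((π v).symm i), this, h3]

end part3

section part4
set_option linter.unusedSectionVars false
open scoped Classical
open scoped Nat

variable {V : Type*} [Fintype V]

/-- partner function of the two removed edges -/
noncomputable def mate (t : V × V × V × V) (i : V) : Option V :=
  if i = t.1 then some t.2.1 else if i = t.2.1 then some t.1 else
  if i = t.2.2.1 then some t.2.2.2 else if i = t.2.2.2 then some t.2.2.1 else none

/-- Distinctness -/
def Dist4 (t : V × V × V × V) : Prop :=
  t.1 ≠ t.2.1 ∧ t.1 ≠ t.2.2.1 ∧ t.1 ≠ t.2.2.2 ∧ t.2.1 ≠ t.2.2.1 ∧ t.2.1 ≠ t.2.2.2 ∧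
    t.2.2.1 ≠ t.2.2.2

lemma mate_symm (t : V × V × V × V) (ht : Dist4 t) (i j : V) (h : mate t i = some j) :
    mate t j = some i := by
  obtain ⟨a, b, c, d⟩ := t
  obtain ⟨h1, h2, h3, h4, h5, h6⟩ := ht
  simp only [mate] at *
  split_ifs at h with k1 k2 k3 k4 <;> simp only [Option.some.injEq] at h <;> subst h <;>
    simp_all [eq_comm]

lemma mate_adj (G : SimpleGraph V) (t : V × V × V × V) (hab : G.Adj t.1 t.2.1)
    (hcd : G.Adj t.2.2.1 t.2.2.2) (i j : V) (h : mate t i = some j) : G.Adj i j := by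
  obtain ⟨a, b, c, d⟩ := t
  simp only [mate] at *
  split_ifs at h with k1 k2 k3 k4 <;> simp only [Option.some.injEq] at h <;> subst h <;>
    simp_all [SimpleGraph.adj_comm]

lemma mate_ne_none (t : V × V × V × V) (i : V) :
    mate t i ≠ none ↔ i ∈ ({t.1, t.2.1, t.2.2.1, t.2.2.2} : Set V) := by
  obtain ⟨a, b, c, d⟩ := t
  simp only [mate, Set.mem_insert_iff, Set.mem_singleton_iff]
  split_ifs with k1 k2 k3 k4 <;> simp_all

noncomputable def insG (G : SimpleGraph V) (t : V × V × V × V) (ht : Dist4 t) :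
    SimpleGraph (Option V) where
  Adj x y := match x, y with
    | none, none => False
    | none, some j => mate t j ≠ none
    | some i, none => mate t i ≠ none
    | some i, some j => G.Adj i j ∧ mate t i ≠ some j
  symm := ⟨by
    rintro (_ | i) (_ | j) h
    · exact h
    · exact h
    · exact h
    · exact ⟨h.1.symm, fun h' => h.2 (mate_symm t ht _ _ h')⟩⟩
  loopless := ⟨by
    rintro (_ | i) h
    · exact h
    · exact G.loopless.irrefl _ h.1⟩

lemma insG_reg (G : SimpleGraph V) (t : V × V × V × V) (ht : Dist4 t)
    (hab : G.Adj t.1 t.2.1) (hcd : G.Adj t.2.2.1 t.2.2.2)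
    (hG : ∀ v, (G.neighborSet v).ncard = 4) : ∀ v, ((insG G t ht).neighborSet v).ncard = 4 := by
  rintro (_ | i)
  · have : (insG G t ht).neighborSet none =
        Set.image some ({t.1, t.2.1, t.2.2.1, t.2.2.2} : Set V) := by
      ext (_ | j)
      · simp [insG]
      · simp only [SimpleGraph.mem_neighborSet, insG, Set.mem_image, Option.some.injEq,
          exists_eq_right]
        exact mate_ne_none t j
    rw [this, Set.ncard_image_of_injective _ (Option.some_injective _)]
    obtain ⟨h1, h2, h3, h4, h5, h6⟩ := ht
    rw [Set.ncard_insert_of_notMem (by simp [h1, h2, h3]),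
      Set.ncard_insert_of_notMem (by simp [h4, h5]), Set.ncard_pair h6]
  · rcases hm : mate t i with _ | j
    · have : (insG G t ht).neighborSet (some i) = Set.image some (G.neighborSet i) := by
        ext (_ | j)
        · simp [insG, hm]
        · simp [insG, hm]
      rw [this, Set.ncard_image_of_injective _ (Option.some_injective _), hG]
    · have : (insG G t ht).neighborSet (some i) =
          insert none (Set.image some (G.neighborSet i \ {j})) := by
        ext (_ | k)
        · simp [insG, hm]
        · simp [insG, hm, eq_comm]
      have hadj := mate_adj G t hab hcd i j hm
      rw [this, Set.ncard_insert_of_notMem (by simp),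
        Set.ncard_image_of_injective _ (Option.some_injective _),
        Set.ncard_sdiff_singleton_of_mem (by simpa using hadj), hG]

noncomputable def tups (G : SimpleGraph V) : Finset (V × V × V × V) :=
  Finset.univ.filter (fun t => Dist4 t ∧ G.Adj t.1 t.2.1 ∧ G.Adj t.2.2.1 t.2.2.2)

lemma tups_card (G : SimpleGraph V) (hG : ∀ v, (G.neighborSet v).ncard = 4) :
    (4 * Fintype.card V) * (4 * Fintype.card V - 16) ≤ (tups G).card := by
  have hN : ∀ v, (Finset.univ.filter (fun u => G.Adj v u)).card = 4 := by
    intro v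
    rw [← hG v, ← Set.ncard_coe_finset]
    congr 1
    ext; simp
  set D : Finset (V × V) := Finset.univ.filter (fun p => G.Adj p.1 p.2) with hD
  have hDc : D.card = 4 * Fintype.card V := by
    have : D = Finset.map (Equiv.sigmaEquivProd V V).toEmbedding
        ((Finset.univ : Finset V).sigma (fun v => Finset.univ.filter (fun u => G.Adj v u))) := by
      ext ⟨a, b⟩
      simp [hD]
    rw [this, Finset.card_map, Finset.card_sigma]
    simp [hN, mul_comm]
  have hf1 : ∀ a, (D.filter (fun p => p.1 = a)).card ≤ 4 := by
    intro a
    rw [← hN a]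
    apply Finset.card_le_card_of_injOn (fun p => p.2)
    · rintro ⟨x, y⟩ h
      simp [hD] at h ⊢
      rw [← h.2]; exact h.1
    · rintro ⟨x, y⟩ h ⟨x', y'⟩ h' e
      simp [hD] at h h' e
      simp [h.2, h'.2, e]
  have hf2 : ∀ a, (D.filter (fun p => p.2 = a)).card ≤ 4 := by
    intro a
    rw [← hN a]
    apply Finset.card_le_card_of_injOn (fun p => p.1)
    · rintro ⟨x, y⟩ h
      simp [hD] at h ⊢
      rw [← h.2]; exact h.1.symm
    · rintro ⟨x, y⟩ h ⟨x', y'⟩ h' e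
      simp [hD] at h h' e
      simp [h.2, h'.2, e]
  have hin : ∀ p ∈ D, 4 * Fintype.card V - 16 ≤
      (D.filter (fun q => q.1 ≠ p.1 ∧ q.1 ≠ p.2 ∧ q.2 ≠ p.1 ∧ q.2 ≠ p.2)).card := by
    intro p hp
    have hsub : D ⊆ (D.filter (fun q => q.1 ≠ p.1 ∧ q.1 ≠ p.2 ∧ q.2 ≠ p.1 ∧ q.2 ≠ p.2)) ∪
        ((D.filter (fun q => q.1 = p.1) ∪ D.filter (fun q => q.1 = p.2)) ∪
        (D.filter (fun q => q.2 = p.1) ∪ D.filter (fun q => q.2 = p.2))) := by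
      intro q hq
      simp only [Finset.mem_union, Finset.mem_filter, hq, true_and]
      tauto
    have h1 := Finset.card_le_card hsub
    have h2 := Finset.card_union_le (D.filter (fun q => q.1 ≠ p.1 ∧ q.1 ≠ p.2 ∧ q.2 ≠ p.1 ∧ q.2 ≠ p.2))
        ((D.filter (fun q => q.1 = p.1) ∪ D.filter (fun q => q.1 = p.2)) ∪
        (D.filter (fun q => q.2 = p.1) ∪ D.filter (fun q => q.2 = p.2)))
    have h3 := Finset.card_union_le (D.filter (fun q => q.1 = p.1) ∪ D.filter (fun q => q.1 = p.2))
        (D.filter (fun q => q.2 = p.1) ∪ D.filter (fun q => q.2 = p.2))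
    have h4 := Finset.card_union_le (D.filter (fun q => q.1 = p.1)) (D.filter (fun q => q.1 = p.2))
    have h5 := Finset.card_union_le (D.filter (fun q => q.2 = p.1)) (D.filter (fun q => q.2 = p.2))
    have := hf1 p.1
    have := hf1 p.2
    have := hf2 p.1
    have := hf2 p.2
    omega
  calc (4 * Fintype.card V) * (4 * Fintype.card V - 16) 
      ≤ ∑ p ∈ D, (D.filter (fun q => q.1 ≠ p.1 ∧ q.1 ≠ p.2 ∧ q.2 ≠ p.1 ∧ q.2 ≠ p.2)).card := by
        rw [← hDc, ← smul_eq_mul]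
        rw [← hDc] at hin
        exact Finset.card_nsmul_le_sum _ _ _ hin
    _ = (D.sigma (fun p => D.filter (fun q => q.1 ≠ p.1 ∧ q.1 ≠ p.2 ∧ q.2 ≠ p.1 ∧ q.2 ≠ p.2))).card := by
        rw [Finset.card_sigma]
    _ ≤ _ := by
        apply Finset.card_le_card_of_injOn (fun z => (z.1.1, z.1.2, z.2.1, z.2.2))
        · rintro ⟨⟨a, b⟩, ⟨c, d⟩⟩ h
          simp [hD] at h
          obtain ⟨h1, h2, h3, h4, h5, h6⟩ := h
          simp only [tups, Finset.coe_filter, Finset.mem_univ, true_and, Set.mem_ofPred_eq]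
          exact ⟨⟨h1.ne, Ne.symm h3, Ne.symm h5, Ne.symm h4, Ne.symm h6, h2.ne⟩, h1, h2⟩
        · rintro ⟨⟨a, b⟩, ⟨c, d⟩⟩ h ⟨⟨a', b'⟩, ⟨c', d'⟩⟩ h' e
          simp at e
          simp [e]

/-- tuples of distinct neighbours of `none`. -/
noncomputable def tups' (G : SimpleGraph (Option V)) : Finset (V × V × V × V) :=
  Finset.univ.filter (fun t => Dist4 t ∧ G.Adj none (some t.1) ∧ G.Adj none (some t.2.1)
    ∧ G.Adj none (some t.2.2.1) ∧ G.Adj none (some t.2.2.2))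

lemma tups'_card (G : SimpleGraph (Option V)) (hG : (G.neighborSet none).ncard = 4) :
    (tups' G).card ≤ 24 := by
  have : Fintype.card (Fin 4 ↪ G.neighborSet none) = 24 := by
    rw [Fintype.card_embedding_eq, ← Nat.card_eq_fintype_card (α := G.neighborSet none)]
    rw [show Nat.card (G.neighborSet none) = 4 from hG]
    simp [Nat.descFactorial]
  rw [← this, ← Finset.card_univ]
  have hex2 : ∀ t : V × V × V × V, t ∈ tups' G → ∃ e : Fin 4 ↪ G.neighborSet none,
      (e 0 : Option V) = some t.1 ∧ (e 1 : Option V) = some t.2.1 ∧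
      (e 2 : Option V) = some t.2.2.1 ∧ (e 3 : Option V) = some t.2.2.2 := by
    rintro ⟨a, b, c, d⟩ ht
    simp only [tups', Finset.mem_filter, Finset.mem_univ, true_and] at ht
    obtain ⟨⟨h1, h2, h3, h4, h5, h6⟩, g1, g2, g3, g4⟩ := ht
    refine ⟨⟨![⟨some a, g1⟩, ⟨some b, g2⟩, ⟨some c, g3⟩, ⟨some d, g4⟩], ?_⟩, rfl, rfl, rfl, rfl⟩
    intro i j hij
    have hij' := congrArg Subtype.val hij
    clear hij this
    fin_cases i <;> fin_cases j <;> simp_all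
  have hne : Nonempty (Fin 4 ↪ G.neighborSet none) := by
    rw [← Fintype.card_pos_iff, this]; norm_num
  choose! e he using hex2
  apply Finset.card_le_card_of_injOn e (fun _ _ => Finset.mem_coe.2 (Finset.mem_univ _))
  rintro ⟨a, b, c, d⟩ ht ⟨a', b', c', d'⟩ ht' heq
  have k := he _ (Finset.mem_coe.1 ht)
  have k' := he _ (Finset.mem_coe.1 ht')
  rw [heq] at k
  obtain ⟨k1, k2, k3, k4⟩ := k
  obtain ⟨k1', k2', k3', k4'⟩ := k'
  rw [k1'] at k1; rw [k2'] at k2; rw [k3'] at k3; rw [k4'] at k4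
  simp at k1 k2 k3 k4
  simp [k1, k2, k3, k4]

lemma regG_option : (regG V).card * ((4 * Fintype.card V) * (4 * Fintype.card V - 16)) ≤
    (regG (Option V)).card * 24 := by
  calc (regG V).card * ((4 * Fintype.card V) * (4 * Fintype.card V - 16)) 
      ≤ ∑ G ∈ regG V, (tups G).card := by
        rw [← smul_eq_mul]
        apply Finset.card_nsmul_le_sum
        intro G hG
        exact tups_card G (by simpa [regG] using hG)
    _ = ((regG V).sigma (fun G => tups G)).card := by rw [Finset.card_sigma]
    _ ≤ ((regG (Option V)).sigma (fun G => tups' G)).card := by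
        apply Finset.card_le_card_of_injOn
          (fun z => if h : Dist4 z.2 then ⟨insG z.1 z.2 h, z.2⟩ else ⟨⊥, z.2⟩)
        · rintro ⟨G, t⟩ h
          simp [regG, tups] at h
          obtain ⟨hG, ht, hab, hcd⟩ := h
          simp only [ht, dif_pos, Finset.coe_sigma, Set.mem_sigma_iff, Finset.mem_coe]
          constructor
          · simp only [regG, Finset.mem_filter, Finset.mem_univ, true_and]
            exact insG_reg G t ht hab hcd hG
          · simp only [tups', Finset.mem_filter, Finset.mem_univ, true_and, ht]
            refine ⟨?_, ?_, ?_, ?_⟩ <;>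
            · show mate t _ ≠ none
              rw [mate_ne_none]
              simp
        · rintro ⟨G, t⟩ h ⟨G', t'⟩ h' e
          simp [regG, tups] at h h'
          obtain ⟨hG, ht, hab, hcd⟩ := h
          obtain ⟨hG', ht', hab', hcd'⟩ := h'
          simp only [ht, ht', dif_pos] at e
          have e2 : t = t' := congrArg Sigma.snd e
          subst e2
          have e1 : insG G t ht = insG G' t ht := congrArg Sigma.fst e
          congr 1
          ext i j
          have : ∀ H : SimpleGraph V, H.Adj t.1 t.2.1 → H.Adj t.2.2.1 t.2.2.2 →
              (H.Adj i j ↔ ((insG H t ht).Adj (some i) (some j) ∨ mate t i = some j)) := by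
            intro H h1 h2
            simp only [insG]
            constructor
            · intro h; by_cases hm : mate t i = some j
              · exact Or.inr hm
              · exact Or.inl ⟨h, hm⟩
            · rintro (h | h)
              · exact h.1
              · exact mate_adj H t h1 h2 i j h
          rw [this G hab hcd, this G' hab' hcd', e1]
    _ = ∑ G ∈ regG (Option V), (tups' G).card := by rw [Finset.card_sigma]
    _ ≤ _ := by
        rw [← smul_eq_mul]
        apply Finset.sum_le_card_nsmul
        intro G hG
        apply tups'_card
        simp only [regG, Finset.mem_filter, Finset.mem_univ, true_and] at hG
        exact hG none

lemma regG_equiv {W : Type*} [Fintype W] (e : V ≃ W) : (regG V).card ≤ (regG W).card := by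
  apply Finset.card_le_card_of_injOn (fun G => G.comap e.symm)
  · intro G hG
    simp only [regG, Finset.coe_filter, Finset.mem_univ, true_and, Set.mem_ofPred_eq] at hG ⊢
    intro w
    have : (G.comap e.symm).neighborSet w = Set.image e (G.neighborSet (e.symm w)) := by
      ext x
      simp
    rw [this, Set.ncard_image_of_injective _ e.injective, hG]
  · intro G _ G' _ h
    ext i j
    have := congrArg (fun H : SimpleGraph W => H.Adj (e i) (e j)) h
    simpa using this

lemma regG_succ (n : ℕ) : (regG (Fin n)).card * ((4 * n) * (4 * n - 16)) ≤
    (regG (Fin (n+1))).card * 24 := by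
  have h1 := regG_option (V := Fin n)
  have h2 := regG_equiv (finSuccEquiv n).symm
  rw [Fintype.card_fin] at h1
  exact h1.trans (Nat.mul_le_mul_right _ h2)

lemma regG_five : 1 ≤ (regG (Fin 5)).card := by
  apply Finset.card_pos.2
  refine ⟨⊤, ?_⟩
  simp only [regG, Finset.mem_filter, Finset.mem_univ, true_and]
  intro v
  have : (⊤ : SimpleGraph (Fin 5)).neighborSet v = ((Finset.univ.erase v : Finset (Fin 5)) : Set (Fin 5)) := by
    ext; simp [eq_comm]
  rw [this, Set.ncard_coe_finset]
  simp

lemma lower_aux (K N N' T j D : ℝ) (hK : 0 ≤ K) (hN : 0 ≤ N) (hT : 0 ≤ T) (hj : 0 ≤ j)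
    (ih : D ≤ K * T * ((j+1) * (j+2) * (j+3) * (j+4) * (j+5) * (j+6)) * N)
    (hs : N * ((4 * (j+5)) * (4 * j + 4)) ≤ N' * 24) :
    (4 * j + 23) * ((4 * j + 21) * D) ≤
      K * (T * 24) * ((j+1+1) * (j+1+2) * (j+1+3) * (j+1+4) * (j+1+5) * (j+1+6)) * N' := by
  have h1 : (4 * j + 23) * ((4 * j + 21) * D) ≤ (4 * j + 23) * ((4 * j + 21) * 
      (K * T * ((j+1) * (j+2) * (j+3) * (j+4) * (j+5) * (j+6)) * N)) := by
    apply mul_le_mul_of_nonneg_left _ (by linarith)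
    apply mul_le_mul_of_nonneg_left ih (by linarith)
  have h2 : (4 * j + 23) * (4 * j + 21) ≤ 16 * (j+7) * (j+5) := by nlinarith
  have h0 : 0 ≤ K * T * ((j+1) * (j+2) * (j+3) * (j+4) * (j+5) * (j+6)) * N := by
    positivity
  have h3 := mul_le_mul_of_nonneg_right h2 h0
  have h4 : 0 ≤ K * T * ((j+2) * (j+3) * (j+4) * (j+5) * (j+6) * (j+7)) := by positivity
  have h5 := mul_le_mul_of_nonneg_left hs h4
  calc _ ≤ _ := h1
    _ = (4 * j + 23) * (4 * j + 21) * 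
      (K * T * ((j+1) * (j+2) * (j+3) * (j+4) * (j+5) * (j+6)) * N) := by ring
    _ ≤ _ := h3
    _ = K * T * ((j+2) * (j+3) * (j+4) * (j+5) * (j+6) * (j+7)) * (N * ((4 * (j+5)) * (4 * j + 4))) := by ring
    _ ≤ _ := h5
    _ = _ := by ring

lemma regG_lower (j : ℕ) : (((4 * (j + 5) - 1)‼ : ℕ) : ℝ) ≤
    ((19‼ : ℕ) : ℝ) * 24 ^ (j+5) * ((j+1) * (j+2) * (j+3) * (j+4) * (j+5) * (j+6) : ℝ) * (regG (Fin (j+5))).card := by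
  induction j with
  | zero =>
    have := regG_five
    have h : (1:ℝ) ≤ (regG (Fin 5)).card := by exact_mod_cast this
    norm_num
    have h19 : (0:ℝ) < ((19‼ : ℕ) : ℝ) := by exact_mod_cast Nat.doubleFactorial_pos 19
    nlinarith
  | succ j ih =>
    have hs := regG_succ (j+5)
    have hs' : ((regG (Fin (j+5))).card : ℝ) * ((4 * (j+5)) * (4 * j + 4)) ≤
        (regG (Fin (j+1+5))).card * 24 := by
      have e : 4 * (j+5) - 16 = 4 * j + 4 := by omega
      rw [e] at hs
      rw [show j + 1 + 5 = j + 5 + 1 by omega]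
      exact_mod_cast hs
    have e1 : (4 * (j + 1 + 5) - 1)‼ = (4*j+23) * ((4*j+21) * (4 * (j+5) - 1)‼) := by
      rw [show 4 * (j+1+5) - 1 = 4*j+19+2+2 by omega, show 4*(j+5) - 1 = 4*j+19 by omega,
        Nat.doubleFactorial_add_two, Nat.doubleFactorial_add_two]
    rw [e1]
    push_cast
    have hK : (0:ℝ) ≤ ((19‼ : ℕ) : ℝ) := Nat.cast_nonneg _
    have hN : (0:ℝ) ≤ ((regG (Fin (j+5))).card : ℝ) := Nat.cast_nonneg _
    have hT : (0:ℝ) ≤ 24 ^ (j+5) := by positivity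
    have hj : (0:ℝ) ≤ j := Nat.cast_nonneg _
    rw [show (24:ℝ) ^ (j+1+5) = 24 ^ (j+5) * 24 by ring]
    exact lower_aux _ _ _ _ _ _ hK hN hT hj ih hs'

end part4

section part1
open scoped Classical
open scoped Nat

noncomputable def rr (m0 : ℕ) : ℕ → ℝ
  | 0 => 1
  | k+1 => rr m0 k * (1 - 1 / (m0 + 2 * k - 1 : ℝ))

noncomputable def yy (r : ℝ) : ℝ := 1 - 29701/1000000 * r^3
noncomputable def xx (r : ℝ) : ℝ :=
  1 - (4 * (29701/1000000) * r^3 - (4 * (29701/1000000) - 3940399/100000000) * r^4)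

noncomputable def fwt (r : ℝ) (c : ℕ) : ℝ := if c ≤ 2 then 1 else if c = 3 then yy r else xx r

lemma rr_bounds (m0 : ℕ) (hm : 10 ≤ m0) (k : ℕ) : 0 < rr m0 k ∧ rr m0 k ≤ 1 ∧
    (m0 - 3 : ℝ) ≤ rr m0 k ^ 2 * (m0 + 2 * k - 3) := by
  have hm' : (10:ℝ) ≤ m0 := by exact_mod_cast hm
  induction k with
  | zero => simp [rr]
  | succ k ih =>
    obtain ⟨h1, h2, h3⟩ := ih
    have hk : (0:ℝ) ≤ k := Nat.cast_nonneg _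
    set q : ℝ := m0 + 2 * k - 1 with hq
    have hq9 : 9 ≤ q := by rw [hq]; linarith
    have e1 : 0 < 1 / q := by positivity
    have e2 : 1 / q ≤ 1 / 9 := by apply one_div_le_one_div_of_le <;> linarith
    have hr : rr m0 (k+1) = rr m0 k * (1 - 1/q) := rfl
    rw [hr]
    refine ⟨by apply mul_pos h1; linarith, by nlinarith, ?_⟩
    have e3 : (m0 + 2 * ((k+1 : ℕ) : ℝ) - 3) = q := by rw [hq]; push_cast; ring
    have e4 : (m0 + 2 * (k : ℝ) - 3) = q - 2 := by rw [hq]; ring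
    rw [e3]; rw [e4] at h3
    have e5 : (1 - 1/q)^2 * q = q - 2 + 1/q := by field_simp; ring
    calc (m0 - 3 : ℝ) ≤ rr m0 k ^ 2 * (q - 2) := h3
      _ ≤ rr m0 k ^ 2 * ((1 - 1/q)^2 * q) := by
          apply mul_le_mul_of_nonneg_left _ (sq_nonneg _)
          rw [e5]; linarith
      _ = _ := by ring

lemma xx_le_yy (r : ℝ) (h0 : 0 < r) (h1 : r ≤ 1) : xx r ≤ yy r := by
  unfold xx yy
  have h3 : 0 < r^3 := by positivity
  nlinarith

lemma yy_le_one (r : ℝ) (h0 : 0 < r) : yy r ≤ 1 := by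
  unfold yy
  have h3 : 0 < r^3 := by positivity
  nlinarith

lemma xx_pos (r : ℝ) (h0 : 0 < r) (h1 : r ≤ 1) : 0 < xx r := by
  unfold xx
  have h3 : r^3 ≤ 1 := pow_le_one₀ h0.le h1
  have h4 : 0 < r^4 := by positivity
  nlinarith

lemma step_aux (r e f : ℝ) (h0 : 0 < r) (h1 : r ≤ 1) (he : 0 < e) (he' : e ≤ 1/9)
    (hf : f * (1 + 2 * e) = e) :
    yy r + 3 * (1 - yy r) * f ≤ yy (r * (1 - e)) ∧
    xx r + 4 * (yy r - xx r) * f ≤ xx (r * (1 - e)) := by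
  have hA0 : 0 ≤ (1 - 3 * f) - (1 - e)^3 := by
    have : ((1 - 3 * f) - (1 - e)^3) * (1 + 2 * e) = e^2 * (3 - 5 * e + 2 * e^2) := by
      linear_combination (-3) * hf
    by_contra hcon
    push Not at hcon
    have h2 : ((1 - 3 * f) - (1 - e)^3) * (1 + 2 * e) < 0 := mul_neg_of_neg_of_pos hcon (by linarith)
    rw [this] at h2
    have : 0 ≤ e^2 * (3 - 5 * e + 2 * e^2) := by
      apply mul_nonneg (sq_nonneg _); nlinarith
    linarith
  have hBA : (1 - 4 * f) - (1 - e)^4 ≤ (1 - 3 * f) - (1 - e)^3 := by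
    have : (((1 - 3 * f) - (1 - e)^3) - ((1 - 4 * f) - (1 - e)^4)) * (1 + 2 * e) =
        e^2 * (1 + 3 * e - 5 * e^2 + 2 * e^3) := by
      linear_combination hf
    by_contra hcon
    push Not at hcon
    have h2 : (((1 - 3 * f) - (1 - e)^3) - ((1 - 4 * f) - (1 - e)^4)) * (1 + 2 * e) < 0 :=
      mul_neg_of_neg_of_pos (by linarith) (by linarith)
    rw [this] at h2
    have : 0 ≤ e^2 * (1 + 3 * e - 5 * e^2 + 2 * e^3) := by
      apply mul_nonneg (sq_nonneg _)
      have : 0 < e^3 := by positivity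
      nlinarith
    linarith
  set A := (1 - 3 * f) - (1 - e)^3 with hA
  set B := (1 - 4 * f) - (1 - e)^4 with hB
  have hr3 : 0 < r^3 := by positivity
  have hr4 : 0 < r^4 := by positivity
  constructor
  · have : yy (r * (1-e)) - (yy r + 3 * (1 - yy r) * f) = 29701/1000000 * (r^3 * A) := by
      unfold yy; rw [hA]; ring
    have : 0 ≤ r^3 * A := by positivity
    linarith
  · have e1 : xx (r * (1-e)) - (xx r + 4 * (yy r - xx r) * f) =
      4 * (29701/1000000) * (r^3 * A) - (4 * (29701/1000000) - 3940399/100000000) * (r^4 * B) := by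
      unfold yy xx; rw [hA, hB]; ring
    have h34 : r^4 ≤ r^3 := by nlinarith
    have e2 : r^4 * B ≤ r^4 * A := mul_le_mul_of_nonneg_left hBA hr4.le
    have e3 : r^4 * A ≤ r^3 * A := mul_le_mul_of_nonneg_right h34 hA0
    have e4 : 0 ≤ r^3 * A := by positivity
    linarith

lemma mat_numeric {V : Type*} [Fintype V] (S : Set V) (m0 k : ℕ) (hm : 10 ≤ m0)
    (hmk : m0 + 2 * k = 4 * Fintype.card V) :
    ((Mat S (Finset.univ : Finset (V × Fin 4))).card : ℝ) ≤
      ((4 * Fintype.card V - 1)‼ : ℕ) * (((99/100 : ℝ) ^ m0)⁻¹ *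
        xx (rr m0 k) ^ (Finset.univ.filter (fun v => v ∉ S)).card) := by
  have hr := rr_bounds m0 hm
  have hm' : (10:ℝ) ≤ m0 := by exact_mod_cast hm
  have hy : ∀ k, 0 < yy (rr m0 k) := fun k =>
    (xx_pos _ (hr k).1 (hr k).2.1).trans_le (xx_le_yy _ (hr k).1 (hr k).2.1)
  have key := mat_bound S (fun k c => fwt (rr m0 k) c) m0 (((99/100 : ℝ) ^ m0)⁻¹) (by positivity)
    (by
      intro k c
      simp only [fwt]
      split_ifs
      · exact one_pos
      · exact hy k
      · exact xx_pos _ (hr k).1 (hr k).2.1)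
    (by intro k c hc; simp [fwt, hc])
    (by
      intro k c
      have a1 := yy_le_one _ (hr k).1
      have a2 := xx_le_yy _ (hr k).1 (hr k).2.1
      simp only [fwt]
      split_ifs <;> first | omega | linarith)
    (by
      intro k c
      have hk : (0:ℝ) ≤ k := Nat.cast_nonneg _
      have a1 := yy_le_one _ (hr k).1
      have a2 := xx_le_yy _ (hr k).1 (hr k).2.1
      have hq9 : (9:ℝ) ≤ m0 + 2 * k - 1 := by linarith
      have hden : (((m0 + 2 * (k+1) : ℕ) : ℝ) - 1) = (m0 + 2 * k - 1) + 2 := by push_cast; ring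
      obtain ⟨s1, s2⟩ := step_aux (rr m0 k) (1 / (m0 + 2 * k - 1 : ℝ)) (1 / ((m0 + 2 * k - 1 : ℝ) + 2))
        (hr k).1 (hr k).2.1 (by positivity) (by apply one_div_le_one_div_of_le <;> linarith)
        (by field_simp)
      have hrs : rr m0 (k+1) = rr m0 k * (1 - 1 / (m0 + 2 * k - 1 : ℝ)) := rfl
      rw [hden, hrs]
      have hfp : 0 ≤ 1 / ((m0 + 2 * k - 1 : ℝ) + 2) := by positivity
      rcases Nat.lt_or_ge c 3 with h | h
      · have b1 : c ≤ 2 := by omega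
        have b2 : c - 1 ≤ 2 := by omega
        simp [fwt, b1, b2]
      rcases Nat.eq_or_lt_of_le h with h | h
      · subst h
        simp [fwt]
        simp at s1
        rw [← div_eq_mul_inv] at s1
        exact s1
      rcases Nat.eq_or_lt_of_le h with h | h
      · simp at h
        subst h
        simp [fwt]
        simp at s2
        rw [← div_eq_mul_inv] at s2
        exact s2
      · have b1 : ¬ c ≤ 2 := by omega
        have b2 : ¬ c - 1 ≤ 2 := by omega
        have b3 : ¬ c = 3 := by omega
        have b4 : ¬ c - 1 = 3 := by omega
        simp only [fwt, b1, b2, b3, b4, if_false, sub_self, mul_zero, zero_div, add_zero]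
        have : 0 ≤ 4 * (yy (rr m0 k) - xx (rr m0 k)) * (1 / ((m0 + 2 * k - 1 : ℝ) + 2)) := by
          apply mul_nonneg _ hfp
          linarith
        linarith)
    (by
      intro P hP
      have hz : (0:ℝ) < (99/100)^m0 := by positivity
      rw [inv_mul_eq_div, le_div_iff₀ hz, one_mul]
      have hsum : ∑ v, cnt P v = m0 := by
        rw [← hP]
        unfold cnt
        exact (Finset.card_eq_sum_card_fiberwise (f := fun x : V × Fin 4 => x.1)
          (t := Finset.univ) (fun x _ => by simp)).symm
      have hpw : (99/100 : ℝ) ^ m0 = ∏ v, (99/100 : ℝ) ^ cnt P v := by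
        rw [Finset.prod_pow_eq_pow_sum, hsum]
      rw [hpw]
      calc ∏ v, (99/100 : ℝ) ^ cnt P v 
          ≤ ∏ v, (if v ∉ S then fwt (rr m0 0) (cnt P v) else 1) := by
            apply Finset.prod_le_prod
            · intros; positivity
            · intro v _
              have h1 : ((99:ℝ)/100)^(cnt P v) ≤ 1 := pow_le_one₀ (by norm_num) (by norm_num)
              split_ifs
              · exact h1
              · unfold fwt
                split_ifs with g1 g2
                · exact h1
                · rw [g2]; norm_num [rr, yy]
                · have : ((99:ℝ)/100)^(cnt P v) ≤ (99/100)^4 :=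
                    pow_le_pow_of_le_one (by norm_num) (by norm_num) (by omega)
                  refine this.trans ?_
                  norm_num [rr, xx]
        _ = _ := by
            unfold wt
            rw [Finset.prod_filter])
    k Finset.univ (by
      rw [Finset.card_univ, Fintype.card_prod, Fintype.card_fin, hmk]; ring)
  rw [hmk] at key
  refine key.trans (le_of_eq ?_)
  congr 2
  unfold wt
  rw [Finset.prod_congr rfl (g := fun _ => xx (rr m0 k)), Finset.prod_const]
  intro v _
  have : cnt (Finset.univ : Finset (V × Fin 4)) v = 4 := by
    unfold cnt
    have : (Finset.univ.filter (fun x : V × Fin 4 => x.1 = v)) = ({v} : Finset V) ×ˢ Finset.univ := by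
      ext ⟨a, b⟩; simp [eq_comm]
    rw [this, Finset.card_product]; simp
  rw [this]
  simp [fwt]

lemma xx_mono (r : ℝ) (h0 : 3/4 ≤ r) (h1 : r ≤ 1) : xx r ≤ xx (3/4) := by
  unfold xx
  have e : (4 * (29701/1000000) * r^3 - (4 * (29701/1000000) - 3940399/100000000) * r^4) -
     (4 * (29701/1000000) * (3/4)^3 - (4 * (29701/1000000) - 3940399/100000000) * (3/4 : ℝ)^4)
     = (r - 3/4) * (4 * (29701/1000000) * (r^2 + r * (3/4) + (3/4)^2)
        - (4 * (29701/1000000) - 3940399/100000000) * (r^3 + r^2 * (3/4) + r * (3/4)^2 + (3/4)^3)) := by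
    ring
  have h3 : r^3 ≤ r^2 := by nlinarith [sq_nonneg r]
  have : 0 ≤ (4 * (29701/1000000) * (r^2 + r * (3/4) + (3/4)^2)
        - (4 * (29701/1000000) - 3940399/100000000) * (r^3 + r^2 * (3/4) + r * (3/4)^2 + (3/4)^3)) := by
    nlinarith [sq_nonneg r]
  nlinarith [mul_nonneg (sub_nonneg.2 h0) this]

lemma bad_numeric (n : ℕ) (hn : 16 ≤ n) (S : Set (Fin n)) :
    ∃ m0 : ℕ, (m0 : ℝ) ≤ 9/4 * n + 4 ∧ 
    (((regG (Fin n)).filter (fun G => IsDynamo G S)).card : ℝ) * 24 ^ n ≤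
      ((4 * n - 1)‼ : ℕ) * (((99/100 : ℝ) ^ m0)⁻¹ *
        xx (3/4) ^ (Finset.univ.filter (fun v => v ∉ S)).card) := by
  set k := 7 * n / 8 - 1 with hk
  have hk1 : 8 * k + 8 ≤ 7 * n := by omega
  have hk2 : 7 * n ≤ 8 * k + 15 := by omega
  obtain ⟨m0, hm0⟩ : ∃ m0, m0 + 2 * k = 4 * n := ⟨4 * n - 2 * k, by omega⟩
  have hk1' : (8 * k + 8 : ℝ) ≤ 7 * n := by exact_mod_cast hk1
  have hk2' : (7 * n : ℝ) ≤ 8 * k + 15 := by exact_mod_cast hk2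
  have hm0' : (m0 + 2 * k : ℝ) = 4 * n := by exact_mod_cast hm0
  have hn' : (16:ℝ) ≤ n := by exact_mod_cast hn
  refine ⟨m0, by linarith, ?_⟩
  have h1 := bad_card_le S
  rw [Fintype.card_fin] at h1
  have h1' : (((regG (Fin n)).filter (fun G => IsDynamo G S)).card : ℝ) * 24 ^ n ≤
    ((Mat S (Finset.univ : Finset (Fin n × Fin 4))).card : ℝ) := by exact_mod_cast h1
  have h2 := mat_numeric S m0 k (by omega) (by rw [Fintype.card_fin]; exact hm0)
  rw [Fintype.card_fin] at h2
  refine h1'.trans (h2.trans ?_)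
  obtain ⟨r1, r2, r3⟩ := rr_bounds m0 (by omega) k
  have hr : 3/4 ≤ rr m0 k := by
    by_contra hcon
    push Not at hcon
    have hsq : rr m0 k ^ 2 ≤ 9/16 := by nlinarith
    have : rr m0 k ^ 2 * (m0 + 2 * k - 3) ≤ 9/16 * (m0 + 2 * k - 3) := 
      mul_le_mul_of_nonneg_right hsq (by linarith)
    linarith
  have hx := xx_mono _ hr r2
  have hx0 := xx_pos _ r1 r2
  gcongr

end part1

section part5
open scoped Classical
open scoped Nat ENNReal

lemma xx34_pos : 0 < xx (3/4) := xx_pos _ (by norm_num) (by norm_num)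

lemma xx34_le : xx (3/4) ≤ 1 :=
  (xx_le_yy _ (by norm_num) (by norm_num)).trans (yy_le_one _ (by norm_num))

noncomputable def rho : ℝ := ((99/100 : ℝ) ^ (9/4 : ℝ))⁻¹ * xx (3/4) ^ (899/1000 : ℝ)

lemma rho_pos : 0 < rho := by
  have := xx34_pos
  unfold rho; positivity

set_option exponentiation.threshold 3000 in
lemma rho_lt : rho < 1 := by
  have hx := xx34_pos
  have h : rho ^ 1000 < 1 := by
    have e : rho ^ 1000 = ((99/100 : ℝ) ^ 2250)⁻¹ * xx (3/4) ^ 899 := by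
      unfold rho
      rw [mul_pow, inv_pow, ← Real.rpow_natCast, ← Real.rpow_mul (by norm_num),
        ← Real.rpow_natCast (xx (3/4) ^ (899/1000 : ℝ)), ← Real.rpow_mul hx.le]
      norm_num
    rw [e, inv_mul_lt_iff₀ (by positivity), mul_one]
    have : xx (3/4) ≤ 97501/100000 := by unfold xx; norm_num
    refine (pow_le_pow_left₀ hx.le this _).trans_lt ?_
    norm_num
  by_contra hcon
  push Not at hcon
  exact absurd (one_le_pow₀ hcon (n := 1000)) (not_le.2 h)

noncomputable def epsn (n : ℕ) : ℝ :=
  (((99/100 : ℝ) ^ (4:ℝ))⁻¹ * ((19‼ : ℕ) : ℝ) * 2 ^ 6) * ((n:ℝ) ^ 6 * rho ^ n)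

lemma bad_final (n : ℕ) (hn : 16 ≤ n) (S : Set (Fin n))
    (hS : (899/1000 : ℝ) * n ≤ (Finset.univ.filter (fun v => v ∉ S)).card) :
    (((regG (Fin n)).filter (fun G => IsDynamo G S)).card : ℝ) ≤
      epsn n * (regG (Fin n)).card := by
  obtain ⟨m0, hm0, hb⟩ := bad_numeric n hn S
  have hx := xx34_pos
  obtain ⟨j, hnj⟩ : ∃ j, n = j + 5 := ⟨n - 5, by omega⟩
  have hl := regG_lower j
  rw [← hnj] at hl
  have hz : (0:ℝ) < 99/100 := by norm_num
  have e1 : ((99/100 : ℝ) ^ m0)⁻¹ ≤ ((99/100 : ℝ) ^ (9/4 * n + 4 : ℝ))⁻¹ := by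
    apply inv_anti₀ (by positivity)
    rw [← Real.rpow_natCast]
    exact Real.rpow_le_rpow_of_exponent_ge hz (by norm_num) hm0
  have e2 : xx (3/4) ^ (Finset.univ.filter (fun v => v ∉ S)).card ≤ xx (3/4) ^ ((899/1000 : ℝ) * n) := by
    rw [← Real.rpow_natCast]
    exact Real.rpow_le_rpow_of_exponent_ge hx xx34_le hS
  have e3 : ((99/100 : ℝ) ^ (9/4 * n + 4 : ℝ))⁻¹ * xx (3/4) ^ ((899/1000 : ℝ) * n) =
      ((99/100 : ℝ) ^ (4:ℝ))⁻¹ * rho ^ n := by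
    rw [Real.rpow_add hz, Real.rpow_mul hz.le, Real.rpow_mul hx.le, Real.rpow_natCast,
      Real.rpow_natCast, rho, mul_pow, mul_inv, inv_pow]
    ring
  have e4 : ((99/100 : ℝ) ^ m0)⁻¹ * xx (3/4) ^ (Finset.univ.filter (fun v => v ∉ S)).card ≤
      ((99/100 : ℝ) ^ (4:ℝ))⁻¹ * rho ^ n := by
    rw [← e3]
    exact mul_le_mul e1 e2 (by positivity) (by positivity)
  have hj : (0:ℝ) ≤ j := Nat.cast_nonneg _
  have hnr : (n:ℝ) = j + 5 := by rw [hnj]; push_cast; ring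
  have e5 : ((j+1) * (j+2) * (j+3) * (j+4) * (j+5) * (j+6) : ℝ) ≤ 2^6 * (n:ℝ)^6 := by
    rw [hnr, ← mul_pow]
    have : (2 * ((j:ℝ)+5))^6 = (2 * ((j:ℝ)+5)) * (2 * ((j:ℝ)+5)) * (2 * ((j:ℝ)+5)) * (2 * ((j:ℝ)+5)) * (2 * ((j:ℝ)+5)) * (2 * ((j:ℝ)+5)) := by ring
    rw [this]
    gcongr <;> linarith
  have hrho := rho_pos
  have h24 : (0:ℝ) < 24 ^ n := by positivity
  refine le_of_mul_le_mul_right ?_ h24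
  have hK : (0:ℝ) ≤ ((19‼ : ℕ) : ℝ) := Nat.cast_nonneg _
  have hN : (0:ℝ) ≤ ((regG (Fin n)).card : ℝ) := Nat.cast_nonneg _
  have hC : (0:ℝ) ≤ ((99/100 : ℝ) ^ (4:ℝ))⁻¹ := by positivity
  have hR : (0:ℝ) ≤ rho ^ n := by positivity
  unfold epsn
  generalize ((19‼ : ℕ) : ℝ) = K at *
  generalize ((99/100 : ℝ) ^ (4:ℝ))⁻¹ = C at *
  generalize rho ^ n = R at *
  generalize ((regG (Fin n)).card : ℝ) = N at *
  generalize (24:ℝ) ^ n = T at *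
  generalize ((j+1) * (j+2) * (j+3) * (j+4) * (j+5) * (j+6) : ℝ) = p at *
  calc _ ≤ _ := hb
    _ ≤ (((4 * n - 1)‼ : ℕ) : ℝ) * (C * R) := mul_le_mul_of_nonneg_left e4 (Nat.cast_nonneg _)
    _ ≤ (K * T * p * N) * (C * R) := mul_le_mul_of_nonneg_right hl (by positivity)
    _ ≤ (K * T * (2^6 * (n:ℝ)^6) * N) * (C * R) := by gcongr
    _ = _ := by ring

lemma epsn_tendsto : Tendsto epsn atTop (nhds 0) := by
  have h := tendsto_pow_const_mul_const_pow_of_abs_lt_one 6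
    (r := rho) (by rw [abs_of_pos rho_pos]; exact rho_lt)
  have := h.const_mul (((99/100 : ℝ) ^ (4:ℝ))⁻¹ * ((19‼ : ℕ) : ℝ) * 2 ^ 6)
  rw [mul_zero] at this
  exact this

/-- Bernoulli weight -/
noncomputable def bw (p : ℝ) (b : Bool) : ℝ := if b then p else 1 - p

noncomputable def trues {n : ℕ} (f : Fin n → Bool) : ℕ :=
  (Finset.univ.filter (fun v => f v = true)).card

lemma seed_singleton (n : ℕ) (p : ℝ) (h0 : 0 ≤ p) (h1 : p ≤ 1) (f : Fin n → Bool) :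
    seedMeasure (Fin n) p {f} = ENNReal.ofReal (∏ v, bw p (f v)) := by
  unfold seedMeasure
  rw [Measure.pi_singleton, ENNReal.ofReal_prod_of_nonneg]
  · apply Finset.prod_congr rfl
    intro v _
    cases f v <;> simp [bernoulliMeasure, bw]
  · intro v _
    unfold bw
    split_ifs <;> linarith

lemma seed_set (n : ℕ) (p : ℝ) (h0 : 0 ≤ p) (h1 : p ≤ 1) (A : Set (Fin n → Bool)) :
    seedMeasure (Fin n) p A =
      ENNReal.ofReal (∑ f ∈ Finset.univ.filter (fun f => f ∈ A), ∏ v, bw p (f v)) := by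
  have hA : A = ((Finset.univ.filter (fun f => f ∈ A) : Finset (Fin n → Bool)) : Set (Fin n → Bool)) := by
    ext; simp
  conv_lhs => rw [hA]
  rw [← sum_measure_singleton, ENNReal.ofReal_sum_of_nonneg]
  · apply Finset.sum_congr rfl
    intro f _
    exact seed_singleton n p h0 h1 f
  · intro f _
    apply Finset.prod_nonneg
    intro v _
    unfold bw
    split_ifs <;> linarith

lemma seed_univ (n : ℕ) (p : ℝ) (h0 : 0 ≤ p) (h1 : p ≤ 1) :
    seedMeasure (Fin n) p Set.univ = 1 := by
  unfold seedMeasure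
  rw [Measure.pi_univ]
  simp [bernoulliMeasure]
  rw [← ENNReal.ofReal_add h0 (by linarith)]
  simp

noncomputable def rho2 : ℝ := ((101/100 : ℝ) ^ (101/1000 : ℝ))⁻¹ * (1001/1000)

lemma rho2_pos : 0 < rho2 := by unfold rho2; positivity

set_option exponentiation.threshold 3000 in
lemma rho2_lt : rho2 < 1 := by
  have h : rho2 ^ 1000 < 1 := by
    have e : rho2 ^ 1000 = ((101/100 : ℝ) ^ 101)⁻¹ * (1001/1000) ^ 1000 := by
      unfold rho2
      rw [mul_pow, inv_pow, ← Real.rpow_natCast, ← Real.rpow_mul (by norm_num)]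
      congr 2
      rw [← Real.rpow_natCast]
      norm_num
    rw [e, inv_mul_lt_iff₀ (by positivity), mul_one]
    norm_num
  by_contra hcon
  push Not at hcon
  exact absurd (one_le_pow₀ hcon (n := 1000)) (not_le.2 h)

lemma chernoff (n : ℕ) (p : ℝ) (h0 : 0 ≤ p) (h1 : p ≤ 0.10) :
    seedMeasure (Fin n) p {f | (101/1000 : ℝ) * n < trues f} ≤ ENNReal.ofReal (rho2 ^ n) := by
  rw [seed_set n p h0 (by norm_num at h1; linarith)]
  apply ENNReal.ofReal_le_ofReal
  have hbw : ∀ b, 0 ≤ bw p b := by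
    intro b; unfold bw; norm_num at h1; split_ifs <;> linarith
  have ht : (0:ℝ) < 101/100 := by norm_num
  calc ∑ f ∈ Finset.univ.filter (fun f : Fin n → Bool => f ∈ {f | (101/1000 : ℝ) * n < trues f}), ∏ v, bw p (f v)
      ≤ ∑ f ∈ Finset.univ.filter (fun f : Fin n → Bool => f ∈ {f | (101/1000 : ℝ) * n < trues f}),
          ((101/100 : ℝ) ^ ((101/1000 : ℝ) * n))⁻¹ * ∏ v, (bw p (f v) * if f v then (101/100 : ℝ) else 1) := by
        apply Finset.sum_le_sum
        intro f hf
        simp only [Finset.mem_filter, Finset.mem_univ, true_and, Set.mem_ofPred_eq] at hf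
        rw [Finset.prod_mul_distrib]
        have e : ∏ v, (if f v then (101/100 : ℝ) else 1) = (101/100 : ℝ) ^ trues f := by
          rw [← Finset.prod_filter, Finset.prod_const]; rfl
        rw [e]
        have h2 : (101/100 : ℝ) ^ ((101/1000 : ℝ) * n) ≤ (101/100 : ℝ) ^ trues f := by
          rw [← Real.rpow_natCast]
          exact Real.rpow_le_rpow_of_exponent_le (by norm_num) hf.le
        have h3 : 0 ≤ ∏ v, bw p (f v) := Finset.prod_nonneg (fun v _ => hbw _)
        rw [inv_mul_eq_div, le_div_iff₀ (by positivity)]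
        exact mul_le_mul_of_nonneg_left h2 h3
    _ ≤ ∑ f : Fin n → Bool,
          ((101/100 : ℝ) ^ ((101/1000 : ℝ) * n))⁻¹ * ∏ v, (bw p (f v) * if f v then (101/100 : ℝ) else 1) := by
        apply Finset.sum_le_sum_of_subset_of_nonneg (Finset.filter_subset _ _)
        intro f _ _
        apply mul_nonneg (by positivity)
        apply Finset.prod_nonneg
        intro v _
        apply mul_nonneg (hbw _)
        split_ifs <;> norm_num
    _ = ((101/100 : ℝ) ^ ((101/1000 : ℝ) * n))⁻¹ * (p * (101/100) + (1 - p)) ^ n := by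
        rw [← Finset.mul_sum]
        congr 1
        have := Finset.prod_univ_sum (fun _ : Fin n => (Finset.univ : Finset Bool))
          (fun _ b => bw p b * if b then (101/100 : ℝ) else 1)
        rw [Fintype.piFinset_univ] at this
        rw [← this]
        simp [bw]
    _ ≤ ((101/100 : ℝ) ^ ((101/1000 : ℝ) * n))⁻¹ * (1001/1000) ^ n := by
        apply mul_le_mul_of_nonneg_left _ (by positivity)
        norm_num at h1
        apply pow_le_pow_left₀ <;> linarith
    _ = rho2 ^ n := by
        rw [rho2, mul_pow, inv_pow, Real.rpow_mul ht.le, Real.rpow_natCast]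

lemma epsn_nonneg (n : ℕ) : 0 ≤ epsn n := by
  have := rho_pos
  unfold epsn; positivity

lemma prob_bound (n : ℕ) (hn : 16 ≤ n) (p : ℝ) (h0 : 0 ≤ p) (h1 : p ≤ 0.10) :
    (∑ G ∈ regG (Fin n), seedMeasure (Fin n) p {f | IsDynamo G {v | f v = true}})
      / ((regG (Fin n)).card : ENNReal) ≤ ENNReal.ofReal (rho2 ^ n) + ENNReal.ofReal (epsn n) := by
  apply ENNReal.div_le_of_le_mul
  have hp1 : p ≤ 1 := by norm_num at h1; linarith
  set μ := seedMeasure (Fin n) p with hμ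
  set B : Set (Fin n → Bool) := {f | (101/1000 : ℝ) * n < trues f} with hB
  have hms : ∀ A : Set (Fin n → Bool), MeasurableSet A := fun A => A.toFinite.measurableSet
  calc ∑ G ∈ regG (Fin n), μ {f | IsDynamo G {v | f v = true}}
      ≤ ∑ G ∈ regG (Fin n), (μ B + μ ({f | IsDynamo G {v | f v = true}} \ B)) := by
        apply Finset.sum_le_sum
        intro G _
        refine (measure_mono ?_).trans (measure_union_le _ _)
        intro f hf
        by_cases h : f ∈ B
        · exact Or.inl h
        · exact Or.inr ⟨hf, h⟩
    _ = (regG (Fin n)).card * μ B +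
        ∑ G ∈ regG (Fin n), μ ({f | IsDynamo G {v | f v = true}} \ B) := by
        rw [Finset.sum_add_distrib, Finset.sum_const, nsmul_eq_mul]
    _ ≤ (regG (Fin n)).card * ENNReal.ofReal (rho2 ^ n) + 
        ENNReal.ofReal (epsn n) * (regG (Fin n)).card := by
        apply add_le_add
        · exact mul_le_mul_right (chernoff n p h0 h1) _
        · have e : ∀ G ∈ regG (Fin n), μ ({f | IsDynamo G {v | f v = true}} \ B) =
            ∫⁻ f, ({f | IsDynamo G {v | f v = true}} \ B).indicator (fun _ => 1) f ∂μ := by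
            intro G _
            rw [lintegral_indicator_const (hms _), one_mul]
          rw [Finset.sum_congr rfl e, ← lintegral_finsetSum _ (fun G _ => measurable_of_finite _)]
          calc _ ≤ ∫⁻ f, ENNReal.ofReal (epsn n) * (regG (Fin n)).card ∂μ := by
                apply lintegral_mono
                intro f
                beta_reduce
                by_cases hf : f ∈ B
                · rw [Finset.sum_eq_zero]
                  · exact zero_le
                  · intro G _
                    apply Set.indicator_of_notMem
                    exact fun h => h.2 hf
                · have e2 : ∑ G ∈ regG (Fin n), ({f | IsDynamo G {v | f v = true}} \ B).indicator 
                      (fun _ => (1 : ℝ≥0∞)) f = 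
                      (((regG (Fin n)).filter (fun G => IsDynamo G {v | f v = true})).card : ℝ≥0∞) := by
                    rw [Finset.card_filter]
                    push_cast
                    apply Finset.sum_congr rfl
                    intro G _
                    by_cases hG : IsDynamo G {v | f v = true}
                    · rw [if_pos hG, Set.indicator_of_mem]
                      exact ⟨hG, hf⟩
                    · rw [if_neg hG, Set.indicator_of_notMem]
                      exact fun h => hG h.1
                  show ∑ G ∈ regG (Fin n), _ ≤ _
                  rw [e2]
                  have hb := bad_final n hn {v | f v = true} (by
                    simp only [hB, Set.mem_ofPred_eq, not_lt] at hf
                    have hc : (trues f) + (Finset.univ.filter (fun v => v ∉ {v | f v = true})).card = n := by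
                      have := Finset.card_filter_add_card_filter_not (s := (Finset.univ : Finset (Fin n)))
                        (fun v => f v = true)
                      simpa [trues] using this
                    have hc' : (trues f : ℝ) + (Finset.univ.filter (fun v => v ∉ {v | f v = true})).card = n := by
                      exact_mod_cast hc
                    have hlast : (899/1000:ℝ)*n ≤ ((Finset.univ.filter (fun v => v ∉ {v | f v = true})).card : ℝ) := by linarith
                    convert hlast)
                  have := ENNReal.ofReal_le_ofReal hb
                  rw [ENNReal.ofReal_mul (epsn_nonneg n), ENNReal.ofReal_natCast,
                    ENNReal.ofReal_natCast] at this
                  exact this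
            _ = _ := by
                rw [lintegral_const, hμ, seed_univ n p h0 hp1, mul_one]
    _ = _ := by ring

end part5

/-- Fix `0 ≤ p ≤ 0.10`.  If a 4-regular simple graph `G` on `Fin n` is chosen uniformly at
random and, independently, each vertex is put into the seed set with probability `p`, then
the probability that the seed set is a dynamo on `G` tends to `0` as `n → ∞`.  (The
probability is written as the average, over all 4-regular graphs on `Fin n`, of the
Bernoulli(p)-probability that the seed set is a dynamo.) -/
theorem regular_not_dynamo_whp (p : ℝ) (hp1 : 0 ≤ p) (hp2 : p ≤ 0.10) :
    Filter.Tendsto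
      (fun n : ℕ =>
        (∑ G ∈ regGraphs n,
            seedMeasure (Fin n) p {f | IsDynamo G {v | f v = true}})
          / ((regGraphs n).card : ENNReal))
      Filter.atTop (nhds 0) := by
  have hreg : ∀ n, regGraphs n = regG (Fin n) := fun n => by
    ext G
    simp only [regGraphs, regG, Finset.mem_filter, Finset.mem_univ, true_and]
  have h1 : Tendsto (fun n : ℕ => ENNReal.ofReal (rho2 ^ n) + ENNReal.ofReal (epsn n)) atTop
      (nhds 0) := by
    have a1 := ENNReal.tendsto_ofReal (tendsto_pow_atTop_nhds_zero_of_lt_one rho2_pos.le rho2_lt)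
    have a2 := ENNReal.tendsto_ofReal epsn_tendsto
    simpa using a1.add a2
  refine tendsto_of_tendsto_of_tendsto_of_le_of_le' tendsto_const_nhds h1
    (Eventually.of_forall fun n => zero_le) ?_
  filter_upwards [eventually_ge_atTop 16] with n hn
  rw [hreg]
  exact prob_bound n hn p hp1 hp2
end
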